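/- arXiv:1906.08965 — 2 statements merged into one kernel-verified Lean document; each statement's English description precedes it below -/
import Mathlib

section
/- Let ρ ∈ [0,1) and M > 0 be given. There exists a unique sequence (a_n)_{n∈ℤ} of positive real numbers which is bounded, satisfies the recurrence a_{n+1} = ζ_{n,ρ}·a_n² for all n ∈ ℤ, and satisfies Σ_{n∈ℤ} 2^{n+ρ} a_n = M. Furthermore, there exist constants A₀ ∈ ℝ and A_M > 0, uniquely determined by M, such that a_n = a_{−∞}(2^n + A₀·2^{2n}) + o(2^{2n}) as n → −∞, and a_n / (a_∞ · 2^{(β−α)n} e^{−A_M·2^n}) → 1 as n → ∞, where a_{−∞} := γ₀·2^{ρ+1}/(k₀ ln 2) and a_∞ := (ln 2)^{−1}·2^{β}·2^{(β−α)(ρ+1)}. -/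
open Filter Topology Asymptotics MeasureTheory

noncomputable section

/-- `ζ_{n,ρ} = ln 2 · k(2^{n+ρ}) / (2^{n+ρ} · γ(2^{n+ρ+1}))`. -/
def zeta (k γ : ℝ → ℝ) (ρ : ℝ) (n : ℤ) : ℝ :=
  Real.log 2 * k ((2:ℝ) ^ ((n:ℝ) + ρ)) / ((2:ℝ) ^ ((n:ℝ) + ρ) * γ ((2:ℝ) ^ ((n:ℝ) + ρ + 1)))

/-- `θ_{n,ρ} = 2 ζ_{n+1,ρ} / ζ_{n,ρ}`. -/
def thetaF (k γ : ℝ → ℝ) (ρ : ℝ) (n : ℤ) : ℝ :=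
  2 * zeta k γ ρ (n + 1) / zeta k γ ρ n

/-- `α_n(A,ρ) = exp(−A·2^n)·exp(−2^n·Σ_{j=n+1}^∞ 2^{−j} ln θ_{j−1,ρ})`
(the tail series is re-indexed by `j = n + 1 + m`, `m ∈ ℕ`). -/
def alphaF (k γ : ℝ → ℝ) (ρ A : ℝ) (n : ℤ) : ℝ :=
  Real.exp (-(A * (2:ℝ) ^ n)) *
    Real.exp (-((2:ℝ) ^ n *
      ∑' m : ℕ, (2:ℝ) ^ (-(n + 1 + (m:ℤ))) * Real.log (thetaF k γ ρ (n + (m:ℤ)))))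

/-- `a_n(A,ρ) = 2 ζ_{n,ρ}⁻¹ α_n(A,ρ)`. -/
def aF (k γ : ℝ → ℝ) (ρ A : ℝ) (n : ℤ) : ℝ := 2 * (zeta k γ ρ n)⁻¹ * alphaF k γ ρ A n

theorem tendsto_int_atTop_of_nat {X : Type*} {l : Filter X} {f : ℤ → X}
    (h : Tendsto (fun n : ℕ => f n) atTop l) : Tendsto f atTop l := by
  rw [← Nat.map_cast_int_atTop]
  exact tendsto_map'_iff.2 h

theorem tendsto_int_atBot_of_nat {X : Type*} {l : Filter X} {f : ℤ → X}
    (h : Tendsto (fun n : ℕ => f (-(n : ℤ))) atTop l) : Tendsto f atBot l := by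
  have h1 : Tendsto (fun n : ℤ => f (-n)) atTop l :=
    tendsto_int_atTop_of_nat (f := fun n : ℤ => f (-n)) h
  simpa [Function.comp_def] using h1.comp tendsto_neg_atBot_atTop

/-- The weighted tail `Σ_{j ≥ n} 2^{-j-1} c_j` of a two-sided sequence. -/
def dyadicTail (c : ℤ → ℝ) (n : ℤ) : ℝ :=
  ∑' m : ℕ, (2:ℝ) ^ (-(n + 1 + (m:ℤ))) * c (n + (m:ℤ))

theorem two_zpow_neg_add (n : ℤ) (m : ℕ) :
    (2:ℝ) ^ (-(n + 1 + (m:ℤ))) = (2:ℝ) ^ (-n) * (1 / 2 / 2 ^ m) := by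
  rw [show -(n + 1 + (m:ℤ)) = -n + (-1) + (-(m:ℤ)) by ring, zpow_add₀ two_ne_zero,
    zpow_add₀ two_ne_zero, zpow_neg _ (m:ℤ), zpow_natCast]
  norm_num
  ring

theorem summable_dyadicTail {c : ℤ → ℝ} {L : ℝ} (hc : Tendsto c atTop (𝓝 L)) (n : ℤ) :
    Summable fun m : ℕ => (2:ℝ) ^ (-(n + 1 + (m:ℤ))) * c (n + (m:ℤ)) := by
  have h1 : Tendsto (fun m : ℕ => ‖c (n + (m:ℤ))‖) atTop (𝓝 ‖L‖) :=
    (hc.comp (tendsto_atTop_add_const_left _ n tendsto_natCast_atTop_atTop)).norm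
  obtain ⟨C, hC⟩ := h1.bddAbove_range
  refine Summable.of_norm_bounded
    (g := fun m : ℕ => ((2:ℝ) ^ (-n) * C) / 2 / 2 ^ m) (summable_geometric_two' _) fun m => ?_
  rw [two_zpow_neg_add, norm_mul, Real.norm_of_nonneg (by positivity)]
  have := hC ⟨m, rfl⟩
  calc _ ≤ (2:ℝ) ^ (-n) * (1 / 2 / 2 ^ m) * C := by gcongr
    _ = _ := by ring

theorem dyadicTail_eq_add {c : ℤ → ℝ} {L : ℝ} (hc : Tendsto c atTop (𝓝 L)) (n : ℤ) :
    dyadicTail c n = (2:ℝ) ^ (-(n + 1)) * c n + dyadicTail c (n + 1) := by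
  unfold dyadicTail
  rw [(summable_dyadicTail hc n).tsum_eq_zero_add]
  congr 1
  · simp
  · refine tsum_congr fun m => ?_
    push_cast
    rw [show n + 1 + ((m:ℤ) + 1) = n + 1 + 1 + m by ring,
      show n + ((m:ℤ) + 1) = n + 1 + m by ring]

theorem tendsto_two_zpow_mul_dyadicTail {c : ℤ → ℝ} {L : ℝ} (hc : Tendsto c atTop (𝓝 L)) :
    Tendsto (fun n : ℤ => (2:ℝ) ^ n * dyadicTail c n) atTop (𝓝 L) := by
  have h1 : ∀ n : ℤ, (2:ℝ) ^ n * dyadicTail c n = ∑' m : ℕ, (1 / 2 / 2 ^ m) * c (n + (m:ℤ)) := by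
    intro n
    rw [dyadicTail, ← tsum_mul_left]
    refine tsum_congr fun m => ?_
    rw [two_zpow_neg_add, zpow_neg]
    have : (2:ℝ) ^ n ≠ 0 := by positivity
    field_simp
  have h2 : ∑' m : ℕ, (1 / 2 / 2 ^ m : ℝ) * L = L := by
    rw [tsum_mul_right, tsum_geometric_two', one_mul]
  simp_rw [h1]
  suffices h : Tendsto (fun n : ℤ => ∑' m : ℕ, (1 / 2 / 2 ^ m : ℝ) * c (n + (m:ℤ))) atTop
      (𝓝 (∑' m : ℕ, (1 / 2 / 2 ^ m : ℝ) * L)) by rwa [h2] at h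
  refine tendsto_tsum_of_dominated_convergence
    (bound := fun m : ℕ => (1 / 2 / 2 ^ m : ℝ) * (‖L‖ + 1))
    ((summable_geometric_two' 1).mul_right _) (fun m => ?_) ?_
  · exact (hc.comp (tendsto_atTop_add_const_right _ _ tendsto_id)).const_mul _
  · obtain ⟨N, hN⟩ := eventually_atTop.1 (hc.norm.eventually_le_const (lt_add_one ‖L‖))
    filter_upwards [eventually_ge_atTop N] with n hn m
    rw [norm_mul, Real.norm_of_nonneg (by positivity)]
    gcongr
    exact hN _ (by omega)

theorem exists_tendsto_dyadicTail_atBot {c : ℤ → ℝ} {L σ : ℝ} (hc : Tendsto c atTop (𝓝 L))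
    (hσ : 1 < σ) (hO : c =O[atBot] fun n : ℤ => (2:ℝ) ^ (σ * n)) :
    ∃ S, Tendsto (dyadicTail c) atBot (𝓝 S) := by
  have hsub : ∀ m : ℕ, dyadicTail c (-((m + 1 : ℕ) : ℤ)) - dyadicTail c (-(m:ℤ)) =
      (2:ℝ) ^ m * c (-(m:ℤ) - 1) := by
    intro m
    rw [dyadicTail_eq_add hc (-((m + 1 : ℕ) : ℤ))]
    push_cast
    rw [show -((m:ℤ) + 1) + 1 = -m by ring, show -((m:ℤ) + 1) = -m - 1 by ring, neg_neg,
      zpow_natCast]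
    ring
  have hsum : Summable fun m : ℕ => (2:ℝ) ^ m * c (-(m:ℤ) - 1) := by
    have ht : Tendsto (fun m : ℕ => -(m:ℤ) - 1) atTop atBot :=
      tendsto_atBot_add_const_right _ _
        (tendsto_neg_atTop_atBot.comp tendsto_natCast_atTop_atTop)
    have h1 := (isBigO_refl (fun m : ℕ => (2:ℝ) ^ m) atTop).mul (hO.comp_tendsto ht)
    refine summable_of_isBigO_nat ?_ h1
    have h2 : Summable fun m : ℕ => (2:ℝ) ^ (-σ) * ((2:ℝ) ^ (1 - σ)) ^ m :=
      (summable_geometric_of_lt_one (by positivity)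
        (Real.rpow_lt_one_of_one_lt_of_neg one_lt_two (by linarith))).mul_left _
    refine h2.congr fun m => ?_
    simp only [Function.comp_apply]
    push_cast
    rw [← Real.rpow_natCast, ← Real.rpow_natCast, ← Real.rpow_mul zero_le_two,
      ← Real.rpow_add two_pos, ← Real.rpow_add two_pos]
    congr 1
    ring
  refine ⟨dyadicTail c 0 + ∑' m : ℕ, (2:ℝ) ^ m * c (-(m:ℤ) - 1), tendsto_int_atBot_of_nat ?_⟩
  refine (hsum.hasSum.tendsto_sum_nat.const_add (dyadicTail c 0)).congr fun n => ?_
  simp_rw [← hsub]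
  rw [Finset.sum_range_sub (fun m : ℕ => dyadicTail c (-(m:ℤ)))]
  simp

theorem tendsto_intCast_real_atBot : Tendsto (fun n : ℤ => (n:ℝ)) atBot atBot :=
  tendsto_intCast_atBot_iff.2 tendsto_id

theorem tendsto_two_zpow_atBot : Tendsto (fun n : ℤ => (2:ℝ) ^ n) atBot (𝓝 0) := by
  simpa [Function.comp_def] using
    (tendsto_rpow_atBot_of_base_gt_one 2 one_lt_two).comp tendsto_intCast_real_atBot

theorem tendsto_two_zpow_atTop : Tendsto (fun n : ℤ => (2:ℝ) ^ n) atTop atTop := by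
  simpa [Function.comp_def] using
    (tendsto_rpow_atTop_of_base_gt_one 2 one_lt_two).comp
      (tendsto_intCast_atTop_atTop (R := ℝ))

theorem tsum_mul_exp_strictAnti {B : ℤ → ℝ} (hB : ∀ n, 0 < B n)
    (hs : ∀ A > 0, Summable fun n : ℤ => B n * Real.exp (-(A * (2:ℝ) ^ n))) :
    StrictAntiOn (fun A => ∑' n : ℤ, B n * Real.exp (-(A * (2:ℝ) ^ n))) (Set.Ioi 0) := by
  intro A hA A' hA' h
  have hterm : ∀ n : ℤ,
      B n * Real.exp (-(A' * (2:ℝ) ^ n)) < B n * Real.exp (-(A * (2:ℝ) ^ n)) := by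
    intro n
    have := hB n
    gcongr
  exact Summable.tsum_lt_tsum (i := 0) (fun n => (hterm n).le) (hterm 0) (hs A' hA') (hs A hA)

theorem exists_tsum_mul_exp_eq {B : ℤ → ℝ} (hB : ∀ n, 0 < B n)
    (hs : ∀ A > 0, Summable fun n : ℤ => B n * Real.exp (-(A * (2:ℝ) ^ n)))
    (hunbdd : ∀ M, ∃ n, M < B n) {M : ℝ} (hM : 0 < M) :
    ∃ A > 0, ∑' n : ℤ, B n * Real.exp (-(A * (2:ℝ) ^ n)) = M := by
  obtain ⟨A₁, hA₁, h₁⟩ : ∃ A > 0, M ≤ ∑' n : ℤ, B n * Real.exp (-(A * (2:ℝ) ^ n)) := by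
    obtain ⟨n, hn⟩ := hunbdd (M * Real.exp 1)
    refine ⟨(2:ℝ) ^ (-n), by positivity, ?_⟩
    refine le_trans ?_ ((hs ((2:ℝ) ^ (-n)) (by positivity)).le_tsum n
      fun j _ => mul_nonneg (hB j).le (Real.exp_nonneg _))
    rw [← zpow_add₀ two_ne_zero, neg_add_cancel, zpow_zero, Real.exp_neg, ← div_eq_mul_inv,
      le_div_iff₀ (Real.exp_pos 1)]
    exact hn.le
  obtain ⟨A₂, hA₂, h₂⟩ : ∃ A > 0, ∑' n : ℤ, B n * Real.exp (-(A * (2:ℝ) ^ n)) ≤ M := by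
    have h0 : Tendsto (fun A : ℝ => ∑' n : ℤ, B n * Real.exp (-(A * (2:ℝ) ^ n))) atTop
        (𝓝 (∑' _ : ℤ, (0:ℝ))) := by
      refine tendsto_tsum_of_dominated_convergence (hs 1 one_pos) (fun n => ?_) ?_
      · have := (Real.tendsto_exp_neg_atTop_nhds_zero.comp
          (tendsto_id.atTop_mul_const (r := (2:ℝ) ^ n) (by positivity))).const_mul (B n)
        simpa [Function.comp_def] using this
      · filter_upwards [eventually_ge_atTop 1] with A hA n
        rw [Real.norm_of_nonneg (mul_nonneg (hB n).le (Real.exp_nonneg _))]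
        have := hB n
        gcongr
    rw [tsum_zero] at h0
    obtain ⟨A, hA, h⟩ := ((eventually_gt_atTop 0).and (h0.eventually_le_const hM)).exists
    exact ⟨A, hA, h⟩
  have hmin : 0 < min A₁ A₂ := lt_min hA₁ hA₂
  have hcont : ContinuousOn (fun A : ℝ => ∑' n : ℤ, B n * Real.exp (-(A * (2:ℝ) ^ n)))
      (Set.Ici (min A₁ A₂)) := by
    refine continuousOn_tsum (fun n => by fun_prop) (hs _ hmin) fun n A hA => ?_
    rw [Real.norm_of_nonneg (mul_nonneg (hB n).le (Real.exp_nonneg _))]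
    have := hB n
    have hA' : min A₁ A₂ ≤ A := hA
    gcongr
  obtain ⟨A, hA, h⟩ := isPreconnected_Ici.intermediate_value (min_le_right A₁ A₂)
    (min_le_left A₁ A₂) hcont ⟨h₂, h₁⟩
  exact ⟨A, hmin.trans_le hA, h⟩

theorem aF_eq (k γ : ℝ → ℝ) (ρ A : ℝ) (n : ℤ) :
    aF k γ ρ A n = 2 * (zeta k γ ρ n)⁻¹ *
      Real.exp (-((2:ℝ) ^ n * (A + dyadicTail (fun j => Real.log (thetaF k γ ρ j)) n))) := by
  rw [aF, alphaF, ← Real.exp_add]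
  congr 2
  simp only [dyadicTail]
  ring

theorem aF_eq_mul_exp (k γ : ℝ → ℝ) (ρ A : ℝ) (n : ℤ) :
    aF k γ ρ A n = aF k γ ρ 0 n * Real.exp (-(A * (2:ℝ) ^ n)) := by
  rw [aF_eq, aF_eq, mul_assoc _ (Real.exp _), ← Real.exp_add]
  congr 2
  ring

section ZetaAsymptotics

variable {k γ : ℝ → ℝ} {ρ s Z : ℝ}

theorem aF_pos (hpos : ∀ n, 0 < zeta k γ ρ n) (A : ℝ) (n : ℤ) : 0 < aF k γ ρ A n := by
  have := hpos n
  rw [aF_eq]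
  positivity

theorem log_thetaF (hpos : ∀ n, 0 < zeta k γ ρ n) (n : ℤ) :
    Real.log (thetaF k γ ρ n) =
      Real.log 2 + Real.log (zeta k γ ρ (n + 1)) - Real.log (zeta k γ ρ n) := by
  rw [thetaF, Real.log_div (mul_pos two_pos (hpos _)).ne' (hpos n).ne',
    Real.log_mul two_ne_zero (hpos _).ne']

theorem tendsto_log_thetaF_atTop (hpos : ∀ n, 0 < zeta k γ ρ n) (hZ : 0 < Z)
    (htop : Tendsto (fun n : ℤ => zeta k γ ρ n * (2:ℝ) ^ (s * n)) atTop (𝓝 Z)) :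
    Tendsto (fun n => Real.log (thetaF k γ ρ n)) atTop (𝓝 ((1 - s) * Real.log 2)) := by
  have h1 := htop.log hZ.ne'
  have h2 := (h1.comp (tendsto_atTop_add_const_right _ (1:ℤ) tendsto_id)).sub h1
  have h3 := h2.add_const ((1 - s) * Real.log 2)
  rw [sub_self, zero_add] at h3
  refine h3.congr fun n => ?_
  simp only [Function.comp_apply, id]
  rw [log_thetaF hpos, Real.log_mul (hpos _).ne' (by positivity),
    Real.log_mul (hpos _).ne' (by positivity), Real.log_rpow two_pos, Real.log_rpow two_pos]
  push_cast
  ring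

theorem isBigO_log_thetaF_atBot {σ l : ℝ} (hpos : ∀ n, 0 < zeta k γ ρ n)
    (hbot : (fun n : ℤ => Real.log (zeta k γ ρ n * (2:ℝ) ^ n) - l) =O[atBot]
      fun n : ℤ => (2:ℝ) ^ (σ * n)) :
    (fun n => Real.log (thetaF k γ ρ n)) =O[atBot] fun n : ℤ => (2:ℝ) ^ (σ * n) := by
  have h1 := hbot.comp_tendsto (tendsto_atBot_add_const_right _ (1:ℤ) tendsto_id)
  have h2 : ((fun n : ℤ => (2:ℝ) ^ (σ * n)) ∘ fun n : ℤ => id n + 1) =O[atBot]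
      fun n : ℤ => (2:ℝ) ^ (σ * n) := by
    refine ((isBigO_refl (fun n : ℤ => (2:ℝ) ^ (σ * n)) atBot).const_mul_left
      ((2:ℝ) ^ σ)).congr_left fun n => ?_
    simp only [Function.comp_apply, id]
    rw [← Real.rpow_add two_pos]
    push_cast
    congr 1
    ring
  refine ((h1.trans h2).sub hbot).congr_left fun n => ?_
  simp only [Function.comp_apply, id]
  rw [log_thetaF hpos, Real.log_mul (hpos _).ne' (by positivity),
    Real.log_mul (hpos _).ne' (by positivity), Real.log_zpow, Real.log_zpow]
  push_cast
  ring

theorem aF_add_one (hpos : ∀ n, 0 < zeta k γ ρ n) (hZ : 0 < Z)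
    (htop : Tendsto (fun n : ℤ => zeta k γ ρ n * (2:ℝ) ^ (s * n)) atTop (𝓝 Z)) (A : ℝ) (n : ℤ) :
    aF k γ ρ A (n + 1) = zeta k γ ρ n * aF k γ ρ A n ^ 2 := by
  have h0 := hpos n
  have h1 := hpos (n + 1)
  have hθ : 0 < thetaF k γ ρ n := by unfold thetaF; positivity
  have hT := dyadicTail_eq_add (tendsto_log_thetaF_atTop hpos hZ htop) n
  rw [aF_eq, aF_eq, mul_pow, ← Real.exp_nat_mul, hT]
  have h2 : ((2:ℕ):ℝ) * -((2:ℝ) ^ n * (A + ((2:ℝ) ^ (-(n + 1)) * Real.log (thetaF k γ ρ n) +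
      dyadicTail (fun j => Real.log (thetaF k γ ρ j)) (n + 1)))) =
      -((2:ℝ) ^ (n + 1) * (A + dyadicTail (fun j => Real.log (thetaF k γ ρ j)) (n + 1))) +
        -Real.log (thetaF k γ ρ n) := by
    rw [zpow_neg, zpow_add_one₀ two_ne_zero]
    have : (2:ℝ) ^ n ≠ 0 := by positivity
    push_cast
    field_simp
    ring
  rw [h2, Real.exp_add, Real.exp_neg (Real.log _), Real.exp_log hθ, thetaF]
  field_simp

theorem exists_eq_aF (hpos : ∀ n, 0 < zeta k γ ρ n) (hZ : 0 < Z)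
    (htop : Tendsto (fun n : ℤ => zeta k γ ρ n * (2:ℝ) ^ (s * n)) atTop (𝓝 Z)) {a : ℤ → ℝ}
    (ha : ∀ n, 0 < a n) (hrec : ∀ n, a (n + 1) = zeta k γ ρ n * a n ^ 2) :
    ∃ A, a = aF k γ ρ A := by
  set K : ℤ → ℝ := fun n => (2:ℝ) ^ (-n) * (Real.log (zeta k γ ρ n) + Real.log (a n) - Real.log 2)
    + dyadicTail (fun j => Real.log (thetaF k γ ρ j)) n with hK
  have hstep : ∀ n, K (n + 1) = K n := by
    intro n
    simp only [hK]
    rw [dyadicTail_eq_add (tendsto_log_thetaF_atTop hpos hZ htop) n, log_thetaF hpos, hrec,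
      Real.log_mul (hpos n).ne' (pow_pos (ha n) 2).ne', Real.log_pow, zpow_neg, zpow_neg,
      zpow_add_one₀ two_ne_zero]
    have : (2:ℝ) ^ n ≠ 0 := by positivity
    push_cast
    field_simp
    ring
  have hconst : ∀ n, K n = K 0 := by
    intro n
    induction n using Int.induction_on with
    | zero => rfl
    | succ i ih => rw [hstep, ih]
    | pred i ih => rw [← ih, ← hstep (-(i:ℤ) - 1), sub_add_cancel]
  refine ⟨-K 0, funext fun n => ?_⟩
  have h2 : (2:ℝ) ^ n ≠ 0 := by positivity
  have h3 : -((2:ℝ) ^ n * (-K 0 + dyadicTail (fun j => Real.log (thetaF k γ ρ j)) n)) =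
      Real.log (zeta k γ ρ n) + Real.log (a n) - Real.log 2 := by
    rw [← hconst n]
    simp only [hK, zpow_neg]
    field_simp
    ring
  rw [aF_eq, h3, Real.exp_sub, Real.exp_add, Real.exp_log (hpos n), Real.exp_log (ha n),
    Real.exp_log two_pos]
  have := (hpos n).ne'
  field_simp

theorem tendsto_aF_div_atTop (hpos : ∀ n, 0 < zeta k γ ρ n) (hZ : 0 < Z)
    (htop : Tendsto (fun n : ℤ => zeta k γ ρ n * (2:ℝ) ^ (s * n)) atTop (𝓝 Z)) (A : ℝ) :
    Tendsto (fun n : ℤ => aF k γ ρ A n / ((2:ℝ) ^ (s * n) * Real.exp (-(A * (2:ℝ) ^ n)))) atTop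
      (𝓝 (Z⁻¹ * (2:ℝ) ^ s)) := by
  have h1 := tendsto_two_zpow_mul_dyadicTail (tendsto_log_thetaF_atTop hpos hZ htop)
  have h2 := ((htop.inv₀ hZ.ne').const_mul 2).mul (Real.continuous_exp.tendsto _ |>.comp h1.neg)
  have h3 : 2 * Z⁻¹ * Real.exp (-((1 - s) * Real.log 2)) = Z⁻¹ * (2:ℝ) ^ s := by
    rw [Real.rpow_def_of_pos two_pos, show -((1 - s) * Real.log 2) = Real.log 2 * s - Real.log 2
      by ring, Real.exp_sub, Real.exp_log two_pos]
    ring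
  rw [h3] at h2
  refine h2.congr fun n => ?_
  have := (hpos n).ne'
  have h4 : (2:ℝ) ^ (s * n) ≠ 0 := by positivity
  rw [aF_eq, mul_add, neg_add, Real.exp_add, mul_comm A]
  simp only [Function.comp_apply]
  field_simp

theorem exists_tendsto_aF_atBot {σ κ : ℝ} (hpos : ∀ n, 0 < zeta k γ ρ n) (hZ : 0 < Z)
    (htop : Tendsto (fun n : ℤ => zeta k γ ρ n * (2:ℝ) ^ (s * n)) atTop (𝓝 Z))
    (hσ : 1 < σ) (hκ : 0 < κ)
    (hbot : (fun n : ℤ => Real.log (zeta k γ ρ n * (2:ℝ) ^ n) - Real.log κ) =O[atBot]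
      fun n : ℤ => (2:ℝ) ^ (σ * n)) (A : ℝ) :
    ∃ A₀ : ℝ, Tendsto (fun n : ℤ => (aF k γ ρ A n -
      2 / κ * ((2:ℝ) ^ n + A₀ * (2:ℝ) ^ (2 * n))) / (2:ℝ) ^ (2 * n)) atBot (𝓝 0) := by
  obtain ⟨S, hS⟩ := exists_tendsto_dyadicTail_atBot (tendsto_log_thetaF_atTop hpos hZ htop) hσ
    (isBigO_log_thetaF_atBot hpos hbot)
  set y : ℤ → ℝ := fun n => Real.log (zeta k γ ρ n * (2:ℝ) ^ n) - Real.log κ with hy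
  have hy0 : Tendsto (fun n => y n / (2:ℝ) ^ n) atBot (𝓝 0) := by
    have h1 := hbot.mul (isBigO_refl (fun n : ℤ => ((2:ℝ) ^ n)⁻¹) atBot)
    have h2 : Tendsto (fun n : ℤ => (2:ℝ) ^ (σ * n) * ((2:ℝ) ^ n)⁻¹) atBot (𝓝 0) := by
      refine ((tendsto_rpow_atBot_of_base_gt_one 2 one_lt_two).comp
        (tendsto_intCast_real_atBot.const_mul_atBot (sub_pos.2 hσ))).congr fun n => ?_
      simp only [Function.comp_apply]
      rw [← zpow_neg, ← Real.rpow_intCast, ← Real.rpow_add two_pos]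
      push_cast
      congr 1
      ring
    exact h1.trans_tendsto h2
  set u : ℤ → ℝ := fun n =>
    -(A + dyadicTail (fun j => Real.log (thetaF k γ ρ j)) n + y n / (2:ℝ) ^ n) with hu
  have hulim : Tendsto u atBot (𝓝 (-(A + S + 0))) := ((hS.const_add A).add hy0).neg
  have haF : ∀ n, aF k γ ρ A n = 2 / κ * (2:ℝ) ^ n * Real.exp ((2:ℝ) ^ n * u n) := by
    intro n
    have h2 : (2:ℝ) ^ n ≠ 0 := by positivity
    have := (hpos n).ne'
    have h3 : (2:ℝ) ^ n * u n = -((2:ℝ) ^ n * (A +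
        dyadicTail (fun j => Real.log (thetaF k γ ρ j)) n)) +
        (Real.log κ - Real.log (zeta k γ ρ n * (2:ℝ) ^ n)) := by
      simp only [hu, hy]
      field_simp
      ring
    rw [h3, Real.exp_add, Real.exp_sub, Real.exp_log hκ,
      Real.exp_log (mul_pos (hpos n) (by positivity)), aF_eq]
    field_simp
  have hexp : Tendsto (fun n : ℤ => (Real.exp ((2:ℝ) ^ n * u n) - 1) / (2:ℝ) ^ n) atBot
      (𝓝 (-(A + S + 0))) := by
    have hv : Tendsto (fun n : ℤ => (2:ℝ) ^ n * u n) atBot (𝓝 0) := by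
      simpa using tendsto_two_zpow_atBot.mul hulim
    have h1 : (fun n : ℤ => Real.exp ((2:ℝ) ^ n * u n) - 1 - (2:ℝ) ^ n * u n) =o[atBot]
        fun n : ℤ => (2:ℝ) ^ n * u n := by
      have := (hasDerivAt_iff_isLittleO.1 (Real.hasDerivAt_exp 0)).comp_tendsto hv
      simpa [Function.comp_def] using this
    have h2 : (fun n : ℤ => (2:ℝ) ^ n * u n) =O[atBot] fun n : ℤ => (2:ℝ) ^ n := by
      simpa using (isBigO_refl (fun n : ℤ => (2:ℝ) ^ n) atBot).mul (hulim.isBigO_one ℝ)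
    have h3 := (h1.trans_isBigO h2).tendsto_div_nhds_zero.add hulim
    rw [zero_add] at h3
    refine h3.congr fun n => ?_
    have h2 : (2:ℝ) ^ n ≠ 0 := by positivity
    field_simp
    ring
  refine ⟨-(A + S + 0), ?_⟩
  have h4 := (hexp.sub_const (-(A + S + 0))).const_mul (2 / κ)
  rw [sub_self, mul_zero] at h4
  refine h4.congr fun n => ?_
  have h2 : (2:ℝ) ^ n ≠ 0 := by positivity
  rw [haF, two_mul, zpow_add₀ two_ne_zero]
  field_simp
  ring

theorem tendsto_aF_mul_atTop (hpos : ∀ n, 0 < zeta k γ ρ n) (hZ : 0 < Z)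
    (htop : Tendsto (fun n : ℤ => zeta k γ ρ n * (2:ℝ) ^ (s * n)) atTop (𝓝 Z)) {A : ℝ}
    (hA : 0 < A) (r : ℝ) :
    Tendsto (fun n : ℤ => aF k γ ρ A n * (2:ℝ) ^ (r * n)) atTop (𝓝 0) := by
  have h1 := (tendsto_rpow_mul_exp_neg_mul_atTop_nhds_zero (s + r) A hA).comp
    tendsto_two_zpow_atTop
  have h2 := (tendsto_aF_div_atTop hpos hZ htop A).mul h1
  rw [mul_zero] at h2
  refine h2.congr fun n => ?_
  simp only [Function.comp_apply]
  rw [← Real.rpow_intCast, ← Real.rpow_mul zero_le_two, mul_comm (n:ℝ), add_mul,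
    Real.rpow_add two_pos, neg_mul]
  field_simp

theorem tendsto_aF_zero_atTop (hpos : ∀ n, 0 < zeta k γ ρ n) (hZ : 0 < Z) (hs : 0 < s)
    (htop : Tendsto (fun n : ℤ => zeta k γ ρ n * (2:ℝ) ^ (s * n)) atTop (𝓝 Z)) :
    Tendsto (aF k γ ρ 0) atTop atTop := by
  have h1 : Tendsto (fun n : ℤ => (2:ℝ) ^ (s * n)) atTop atTop :=
    (tendsto_rpow_atTop_of_base_gt_one 2 one_lt_two).comp
      ((tendsto_intCast_atTop_atTop (R := ℝ)).const_mul_atTop hs)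
  refine ((tendsto_aF_div_atTop hpos hZ htop 0).pos_mul_atTop (by positivity) h1).congr fun n => ?_
  have h2 : (2:ℝ) ^ (s * n) ≠ 0 := by positivity
  simp [h2]

theorem pos_of_aF_le (hpos : ∀ n, 0 < zeta k γ ρ n) (hZ : 0 < Z) (hs : 0 < s)
    (htop : Tendsto (fun n : ℤ => zeta k γ ρ n * (2:ℝ) ^ (s * n)) atTop (𝓝 Z)) {A C : ℝ}
    (hC : ∀ n, aF k γ ρ A n ≤ C) : 0 < A := by
  by_contra! hA
  obtain ⟨n, hn⟩ := ((tendsto_aF_zero_atTop hpos hZ hs htop).eventually_gt_atTop C).exists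
  have h0 := aF_pos hpos 0 n
  have h1 : 1 ≤ Real.exp (-(A * (2:ℝ) ^ n)) :=
    Real.one_le_exp (neg_nonneg.2 (mul_nonpos_of_nonpos_of_nonneg hA (by positivity)))
  have h2 := hC n
  rw [aF_eq_mul_exp] at h2
  nlinarith

theorem tendsto_aF_div_two_zpow_atBot {c A A₀ : ℝ}
    (h : Tendsto (fun n : ℤ => (aF k γ ρ A n -
      c * ((2:ℝ) ^ n + A₀ * (2:ℝ) ^ (2 * n))) / (2:ℝ) ^ (2 * n)) atBot (𝓝 0)) :
    Tendsto (fun n : ℤ => aF k γ ρ A n / (2:ℝ) ^ n) atBot (𝓝 c) := by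
  have h1 := (h.mul tendsto_two_zpow_atBot).add
    (((tendsto_two_zpow_atBot.const_mul A₀).const_add 1).const_mul c)
  rw [mul_zero, mul_zero, add_zero, mul_one, zero_add] at h1
  refine h1.congr fun n => ?_
  have h2 : (2:ℝ) ^ n ≠ 0 := by positivity
  rw [two_mul, zpow_add₀ two_ne_zero]
  field_simp
  ring

theorem summable_aF {c A : ℝ} (hpos : ∀ n, 0 < zeta k γ ρ n) (hZ : 0 < Z)
    (htop : Tendsto (fun n : ℤ => zeta k γ ρ n * (2:ℝ) ^ (s * n)) atTop (𝓝 Z)) (hA : 0 < A)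
    (hbot : Tendsto (fun n : ℤ => aF k γ ρ A n / (2:ℝ) ^ n) atBot (𝓝 c)) :
    Summable fun n : ℤ => (2:ℝ) ^ ((n:ℝ) + ρ) * aF k γ ρ A n := by
  refine Summable.of_nat_of_neg ?_ ?_
  · have h1 := ((tendsto_aF_mul_atTop hpos hZ htop hA 2).comp
      tendsto_natCast_atTop_atTop).isBigO_one ℝ
    have h2 := (isBigO_refl (fun n : ℕ => (2:ℝ) ^ ρ * (1 / 2 : ℝ) ^ n) atTop).mul h1
    refine summable_of_isBigO_nat ((summable_geometric_two.mul_left ((2:ℝ) ^ ρ)).mul_right 1)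
      (h2.congr_left fun n => ?_)
    simp only [Function.comp_apply, Int.cast_natCast]
    rw [Real.rpow_add two_pos, two_mul, Real.rpow_add two_pos, Real.rpow_natCast, one_div,
      inv_pow]
    field_simp
  · have ht : Tendsto (fun n : ℕ => -(n:ℤ)) atTop atBot :=
      tendsto_neg_atTop_atBot.comp tendsto_natCast_atTop_atTop
    have h1 := (hbot.comp ht).isBigO_one ℝ
    have h2 := (isBigO_refl
      (fun n : ℕ => (2:ℝ) ^ ρ * (1 / 2 : ℝ) ^ n * (1 / 2 : ℝ) ^ n) atTop).mul h1
    have h3 : (fun n : ℕ => (2:ℝ) ^ ρ * (1 / 2 : ℝ) ^ n * (1 / 2 : ℝ) ^ n * 1) =O[atTop]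
        fun n : ℕ => (1 / 2 : ℝ) ^ n := by
      refine IsBigO.of_bound ((2:ℝ) ^ ρ) (Eventually.of_forall fun n => ?_)
      rw [Real.norm_of_nonneg (by positivity), Real.norm_of_nonneg (by positivity), mul_one]
      exact mul_le_of_le_one_right (by positivity) (pow_le_one₀ (by norm_num) (by norm_num))
    refine summable_of_isBigO_nat summable_geometric_two
      ((h2.trans h3).congr_left fun n => ?_)
    simp only [Function.comp_apply]
    push_cast
    rw [Real.rpow_add two_pos, zpow_neg, zpow_natCast, Real.rpow_neg zero_le_two,
      Real.rpow_natCast, one_div,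
      inv_pow]
    field_simp

theorem exists_abs_aF_le {c A : ℝ} (hpos : ∀ n, 0 < zeta k γ ρ n) (hZ : 0 < Z)
    (htop : Tendsto (fun n : ℤ => zeta k γ ρ n * (2:ℝ) ^ (s * n)) atTop (𝓝 Z)) (hA : 0 < A)
    (hbot : Tendsto (fun n : ℤ => aF k γ ρ A n / (2:ℝ) ^ n) atBot (𝓝 c)) :
    ∃ C, ∀ n, |aF k γ ρ A n| ≤ C := by
  have h1 : Tendsto (aF k γ ρ A) atTop (𝓝 0) := by
    simpa using tendsto_aF_mul_atTop hpos hZ htop hA 0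
  have h2 : Tendsto (aF k γ ρ A) atBot (𝓝 0) := by
    have := hbot.mul tendsto_two_zpow_atBot
    rw [mul_zero] at this
    refine this.congr fun n => ?_
    have h2 : (2:ℝ) ^ n ≠ 0 := by positivity
    field_simp
  have h3 : Tendsto (aF k γ ρ A) cofinite (𝓝 0) := by
    rw [Int.cofinite_eq]
    exact h2.sup h1
  obtain ⟨C, hC⟩ := h3.abs.isBoundedUnder_le.bddAbove_range_of_cofinite
  exact ⟨C, fun n => hC ⟨n, rfl⟩⟩

end ZetaAsymptotics

theorem eq_of_tendsto_second_order {a : ℤ → ℝ} {c p q : ℝ} (hc : c ≠ 0)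
    (hp : Tendsto (fun n : ℤ => (a n - c * ((2:ℝ) ^ n + p * (2:ℝ) ^ (2 * n))) / (2:ℝ) ^ (2 * n))
      atBot (𝓝 0))
    (hq : Tendsto (fun n : ℤ => (a n - c * ((2:ℝ) ^ n + q * (2:ℝ) ^ (2 * n))) / (2:ℝ) ^ (2 * n))
      atBot (𝓝 0)) : p = q := by
  have h1 : Tendsto (fun _ : ℤ => c * (q - p)) atBot (𝓝 (0 - 0)) := by
    refine (hp.sub hq).congr fun n => ?_
    have h2 : (2:ℝ) ^ (2 * n) ≠ 0 := by positivity
    field_simp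
    ring
  have h2 := tendsto_nhds_unique h1 tendsto_const_nhds
  rw [sub_zero] at h2
  rcases mul_eq_zero.1 h2.symm with h | h
  · exact absurd h hc
  · linarith

theorem eq_of_tendsto_exp_rate {a P : ℤ → ℝ} {p q : ℝ} (ha : ∀ n, 0 < a n) (hP : ∀ n, 0 < P n)
    (hp : Tendsto (fun n : ℤ => a n / (P n * Real.exp (-(p * (2:ℝ) ^ n)))) atTop (𝓝 1))
    (hq : Tendsto (fun n : ℤ => a n / (P n * Real.exp (-(q * (2:ℝ) ^ n)))) atTop (𝓝 1)) :
    p = q := by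
  have h1 := ((hp.log one_ne_zero).sub (hq.log one_ne_zero)).mul
    tendsto_two_zpow_atTop.inv_tendsto_atTop
  have h2 : Tendsto (fun _ : ℤ => p - q) atTop (𝓝 ((Real.log 1 - Real.log 1) * 0)) := by
    refine h1.congr fun n => ?_
    have h2 : (2:ℝ) ^ n ≠ 0 := by positivity
    simp only [Pi.inv_apply]
    have := (hP n).ne'
    rw [Real.log_div (ha n).ne' (by positivity), Real.log_div (ha n).ne' (by positivity),
      Real.log_mul (hP n).ne' (by positivity), Real.log_mul (hP n).ne' (by positivity),
      Real.log_exp, Real.log_exp]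
    field_simp
    ring
  have h3 := tendsto_nhds_unique h2 tendsto_const_nhds
  simp only [mul_zero] at h3
  linarith

theorem isBigO_log_sub_log_comp {f : ℝ → ℝ} {c a σ : ℝ} (hc : 0 < c) (hσ : 0 < σ) (hσa : σ ≤ a)
    (hf : (fun ξ : ℝ => f ξ - c) =O[𝓝[>] 0] fun ξ : ℝ => ξ ^ a) (r : ℝ) :
    (fun n : ℤ => Real.log (f ((2:ℝ) ^ ((n:ℝ) + r))) - Real.log c) =O[atBot]
      fun n : ℤ => (2:ℝ) ^ (σ * n) := by
  have hlim : Tendsto f (𝓝[>] 0) (𝓝 c) := by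
    have h0 : Tendsto (fun ξ : ℝ => ξ ^ a) (𝓝[>] 0) (𝓝 0) := by
      have := (Real.continuousAt_rpow_const 0 a (Or.inr (hσ.le.trans hσa))).tendsto
      rw [Real.zero_rpow (hσ.trans_le hσa).ne'] at this
      exact this.mono_left nhdsWithin_le_nhds
    simpa using (hf.trans_tendsto h0).add_const c
  have h1 : (fun ξ : ℝ => Real.log (f ξ) - Real.log c) =O[𝓝[>] 0] fun ξ : ℝ => f ξ - c :=
    (Real.hasDerivAt_log hc.ne').isBigO_sub.comp_tendsto hlim
  have hx : Tendsto (fun n : ℤ => (2:ℝ) ^ ((n:ℝ) + r)) atBot (𝓝[>] 0) := by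
    refine tendsto_nhdsWithin_iff.2 ⟨(tendsto_rpow_atBot_of_base_gt_one 2 one_lt_two).comp
      (tendsto_atBot_add_const_right _ r tendsto_intCast_real_atBot), Eventually.of_forall fun n => ?_⟩
    exact Real.rpow_pos_of_pos two_pos _
  refine ((h1.trans hf).comp_tendsto hx).trans ?_
  refine IsBigO.of_bound ((2:ℝ) ^ (a * r)) ?_
  filter_upwards [eventually_le_atBot 0] with n hn
  have hn' : (n:ℝ) ≤ 0 := by exact_mod_cast hn
  simp only [Function.comp_apply]
  rw [Real.norm_of_nonneg (by positivity), Real.norm_of_nonneg (by positivity),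
    ← Real.rpow_mul zero_le_two, ← Real.rpow_add two_pos]
  refine Real.rpow_le_rpow_of_exponent_le one_le_two ?_
  nlinarith

theorem zeta_pos {k γ : ℝ → ℝ} (hk : ∀ ξ : ℝ, 0 ≤ ξ → 0 < k ξ) (hγ : ∀ ξ : ℝ, 0 < ξ → 0 < γ ξ)
    (ρ : ℝ) (n : ℤ) : 0 < zeta k γ ρ n := by
  have h1 := hk ((2:ℝ) ^ ((n:ℝ) + ρ)) (by positivity)
  have h2 := hγ ((2:ℝ) ^ ((n:ℝ) + ρ + 1)) (by positivity)
  have h3 := Real.log_pos one_lt_two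
  unfold zeta
  positivity

theorem tendsto_zeta_mul_atTop {k γ : ℝ → ℝ} {α β : ℝ}
    (hk : Tendsto (fun ξ : ℝ => k ξ / ξ ^ (α + 1)) atTop (𝓝 1))
    (hγ : Tendsto (fun ξ : ℝ => γ ξ / ξ ^ β) atTop (𝓝 1)) (ρ : ℝ) :
    Tendsto (fun n : ℤ => zeta k γ ρ n * (2:ℝ) ^ ((β - α) * n)) atTop
      (𝓝 (Real.log 2 * (2:ℝ) ^ (ρ * α - (ρ + 1) * β))) := by
  have hx : ∀ r : ℝ, Tendsto (fun n : ℤ => (2:ℝ) ^ ((n:ℝ) + r)) atTop atTop := fun r =>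
    (tendsto_rpow_atTop_of_base_gt_one 2 one_lt_two).comp
      (tendsto_atTop_add_const_right _ r tendsto_intCast_atTop_atTop)
  have h1 := (((hk.comp (hx ρ)).div (hγ.comp (hx (ρ + 1))) one_ne_zero).const_mul
    (Real.log 2 * (2:ℝ) ^ (ρ * α - (ρ + 1) * β)))
  rw [div_one, mul_one] at h1
  refine h1.congr fun n => ?_
  simp only [Function.comp_apply, zeta, Pi.div_apply]
  rw [← Real.rpow_mul zero_le_two, ← Real.rpow_mul zero_le_two, ← add_assoc]
  have e : (2:ℝ) ^ (ρ * α - (ρ + 1) * β) * (2:ℝ) ^ (((n:ℝ) + ρ + 1) * β) * (2:ℝ) ^ ((n:ℝ) + ρ) =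
      (2:ℝ) ^ ((β - α) * n) * (2:ℝ) ^ (((n:ℝ) + ρ) * (α + 1)) := by
    rw [← Real.rpow_add two_pos, ← Real.rpow_add two_pos, ← Real.rpow_add two_pos]
    congr 1
    ring
  rw [div_div_div_eq, ← mul_div_assoc, div_mul_eq_mul_div]
  by_cases hg : γ ((2:ℝ) ^ ((n:ℝ) + ρ + 1)) = 0
  · simp [hg]
  rw [div_eq_div_iff (by positivity) (by positivity)]
  linear_combination Real.log 2 * k ((2:ℝ) ^ ((n:ℝ) + ρ)) * γ ((2:ℝ) ^ ((n:ℝ) + ρ + 1)) * e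

theorem isBigO_log_zeta_atBot {k γ : ℝ → ℝ} {k₀ γ₀ a b σ : ℝ} (hk₀ : 0 < k₀) (hγ₀ : 0 < γ₀)
    (hk_pos : ∀ ξ : ℝ, 0 ≤ ξ → 0 < k ξ) (hγ_pos : ∀ ξ : ℝ, 0 < ξ → 0 < γ ξ)
    (hσ : 0 < σ) (ha : σ ≤ a) (hb : σ ≤ b)
    (hk : (fun ξ : ℝ => k ξ - k₀) =O[𝓝[>] 0] fun ξ : ℝ => ξ ^ a)
    (hγ : (fun ξ : ℝ => γ ξ - γ₀) =O[𝓝[>] 0] fun ξ : ℝ => ξ ^ b) (ρ : ℝ) :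
    (fun n : ℤ => Real.log (zeta k γ ρ n * (2:ℝ) ^ n) -
      Real.log (Real.log 2 * k₀ / ((2:ℝ) ^ ρ * γ₀))) =O[atBot] fun n : ℤ => (2:ℝ) ^ (σ * n) := by
  refine ((isBigO_log_sub_log_comp hk₀ hσ ha hk ρ).sub
    (isBigO_log_sub_log_comp hγ₀ hσ hb hγ (ρ + 1))).congr_left fun n => ?_
  have h1 := (hk_pos ((2:ℝ) ^ ((n:ℝ) + ρ)) (by positivity)).ne'
  have h2 := (hγ_pos ((2:ℝ) ^ ((n:ℝ) + ρ + 1)) (by positivity)).ne'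
  have h3 := (Real.log_pos one_lt_two).ne'
  have h4 : (2:ℝ) ^ ρ ≠ 0 := by positivity
  have h5 : (2:ℝ) ^ n ≠ 0 := by positivity
  have e : zeta k γ ρ n * (2:ℝ) ^ n = Real.log 2 * k ((2:ℝ) ^ ((n:ℝ) + ρ)) /
      ((2:ℝ) ^ ρ * γ ((2:ℝ) ^ ((n:ℝ) + ρ + 1))) := by
    rw [zeta]
    nth_rewrite 2 [Real.rpow_add two_pos]
    rw [Real.rpow_intCast]
    field_simp
  rw [e, Real.log_div (mul_ne_zero h3 h1) (mul_ne_zero h4 h2),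
    Real.log_div (mul_ne_zero h3 hk₀.ne') (mul_ne_zero h4 hγ₀.ne'), Real.log_mul h3 h1,
    Real.log_mul h4 h2, Real.log_mul h3 hk₀.ne', Real.log_mul h4 hγ₀.ne', add_assoc]
  ring

/-- Proposition: stationary peaks solutions.
For `ρ ∈ [0,1)` and `M > 0` there is a unique positive bounded sequence `(a_n)` with
`a_{n+1} = ζ_{n,ρ} a_n²` and `Σ 2^{n+ρ} a_n = M`; moreover there are unique constants
`A₀ ∈ ℝ`, `A_M > 0` governing the asymptotics of `a_n` as `n → ±∞`. -/
theorem stmt0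
    (α β αb βb k₀ γ₀ : ℝ)
    (hα : α ∈ Set.Ioo (0:ℝ) 1) (hβ : β ∈ Set.Ioo (1:ℝ) 2)
    (hαb : 1 < αb) (hβb : 1 < βb) (hk₀ : 0 < k₀) (hγ₀ : 0 < γ₀)
    (k γ : ℝ → ℝ)
    (hk_cont : ContinuousOn k (Set.Ici 0)) (hk_pos : ∀ ξ : ℝ, 0 ≤ ξ → 0 < k ξ)
    (hk_inf : Tendsto (fun ξ : ℝ => k ξ / ξ ^ (α + 1)) atTop (𝓝 1))
    (hk_0 : (fun ξ : ℝ => k ξ - k₀) =O[𝓝[>] 0] fun ξ : ℝ => ξ ^ αb)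
    (hγ_cont : ContinuousOn γ (Set.Ioi 0)) (hγ_pos : ∀ ξ : ℝ, 0 < ξ → 0 < γ ξ)
    (hγ_inf : Tendsto (fun ξ : ℝ => γ ξ / ξ ^ β) atTop (𝓝 1))
    (hγ_0 : (fun ξ : ℝ => γ ξ - γ₀) =O[𝓝[>] 0] fun ξ : ℝ => ξ ^ βb)
    (ρ : ℝ) (hρ : ρ ∈ Set.Ico (0:ℝ) 1) (M : ℝ) (hM : 0 < M) :
    ∃ a : ℤ → ℝ,
      ((∀ n : ℤ, 0 < a n) ∧ (∃ C : ℝ, ∀ n : ℤ, |a n| ≤ C) ∧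
        (∀ n : ℤ, a (n + 1) = zeta k γ ρ n * (a n) ^ 2) ∧
        Summable (fun n : ℤ => (2:ℝ) ^ ((n:ℝ) + ρ) * a n) ∧
        (∑' n : ℤ, (2:ℝ) ^ ((n:ℝ) + ρ) * a n) = M) ∧
      (∀ a' : ℤ → ℝ,
        ((∀ n : ℤ, 0 < a' n) ∧ (∃ C : ℝ, ∀ n : ℤ, |a' n| ≤ C) ∧
          (∀ n : ℤ, a' (n + 1) = zeta k γ ρ n * (a' n) ^ 2) ∧
          Summable (fun n : ℤ => (2:ℝ) ^ ((n:ℝ) + ρ) * a' n) ∧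
          (∑' n : ℤ, (2:ℝ) ^ ((n:ℝ) + ρ) * a' n) = M) → a' = a) ∧
      (∃! p : ℝ × ℝ, 0 < p.2 ∧
        Tendsto (fun n : ℤ =>
            (a n - γ₀ * (2:ℝ) ^ (ρ + 1) / (k₀ * Real.log 2) *
              ((2:ℝ) ^ n + p.1 * (2:ℝ) ^ (2 * n))) / (2:ℝ) ^ (2 * n)) atBot (𝓝 0) ∧
        Tendsto (fun n : ℤ =>
            a n / ((Real.log 2)⁻¹ * (2:ℝ) ^ β * (2:ℝ) ^ ((β - α) * (ρ + 1)) *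
              ((2:ℝ) ^ ((β - α) * (n:ℝ)) * Real.exp (-(p.2 * (2:ℝ) ^ n))))) atTop (𝓝 1)) := by
  have hpos := zeta_pos hk_pos hγ_pos ρ
  have htop := tendsto_zeta_mul_atTop hk_inf hγ_inf ρ
  have hs : 0 < β - α := by linarith [hα.2, hβ.1]
  have hlog := Real.log_pos one_lt_two
  have hσ : 1 < min αb βb := lt_min hαb hβb
  have hbot := isBigO_log_zeta_atBot hk₀ hγ₀ hk_pos hγ_pos (one_pos.trans hσ) (min_le_left _ _)
    (min_le_right _ _) hk_0 hγ_0 ρ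
  set Z := Real.log 2 * (2:ℝ) ^ (ρ * α - (ρ + 1) * β) with hZdef
  have hZ : 0 < Z := by positivity
  have hκ : 0 < Real.log 2 * k₀ / ((2:ℝ) ^ ρ * γ₀) := by positivity
  have hc : 2 / (Real.log 2 * k₀ / ((2:ℝ) ^ ρ * γ₀)) =
      γ₀ * (2:ℝ) ^ (ρ + 1) / (k₀ * Real.log 2) := by
    rw [Real.rpow_add_one two_ne_zero]
    field_simp
  have hsecond := exists_tendsto_aF_atBot hpos hZ htop hσ hκ hbot
  rw [hc] at hsecond
  have hcpos : 0 < γ₀ * (2:ℝ) ^ (ρ + 1) / (k₀ * Real.log 2) := by positivity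
  have hfirst : ∀ A, Tendsto (fun n : ℤ => aF k γ ρ A n / (2:ℝ) ^ n) atBot
      (𝓝 (γ₀ * (2:ℝ) ^ (ρ + 1) / (k₀ * Real.log 2))) := fun A =>
    let ⟨_, h⟩ := hsecond A
    tendsto_aF_div_two_zpow_atBot h
  have hsum : ∀ A > 0, Summable fun n : ℤ => (2:ℝ) ^ ((n:ℝ) + ρ) * aF k γ ρ A n := fun A hA =>
    summable_aF hpos hZ htop hA (hfirst A)
  have hmass : ∀ A, (fun n : ℤ => (2:ℝ) ^ ((n:ℝ) + ρ) * aF k γ ρ A n) =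
      fun n : ℤ => (2:ℝ) ^ ((n:ℝ) + ρ) * aF k γ ρ 0 n * Real.exp (-(A * (2:ℝ) ^ n)) := fun A =>
    funext fun n => by rw [aF_eq_mul_exp, mul_assoc]
  have hB : ∀ n : ℤ, 0 < (2:ℝ) ^ ((n:ℝ) + ρ) * aF k γ ρ 0 n := fun n =>
    mul_pos (by positivity) (aF_pos hpos 0 n)
  have hsum' := hsum
  simp_rw [hmass] at hsum'
  have hunbdd : ∀ C, ∃ n : ℤ, C < (2:ℝ) ^ ((n:ℝ) + ρ) * aF k γ ρ 0 n := fun C =>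
    ((((tendsto_rpow_atTop_of_base_gt_one 2 one_lt_two).comp
      (tendsto_atTop_add_const_right _ ρ tendsto_intCast_atTop_atTop)).atTop_mul_atTop₀
      (tendsto_aF_zero_atTop hpos hZ hs htop)).eventually_gt_atTop C).exists
  obtain ⟨A, hA, hAM⟩ := exists_tsum_mul_exp_eq hB hsum' hunbdd hM
  refine ⟨aF k γ ρ A, ⟨aF_pos hpos A, exists_abs_aF_le hpos hZ htop hA (hfirst A),
    aF_add_one hpos hZ htop A, hsum A hA, by rw [hmass, hAM]⟩, ?_, ?_⟩
  · rintro a' ⟨hpos', ⟨C, hC⟩, hrec', -, hM'⟩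
    obtain ⟨A', rfl⟩ := exists_eq_aF hpos hZ htop hpos' hrec'
    have hA' : 0 < A' := pos_of_aF_le hpos hZ hs htop fun n => (le_abs_self _).trans (hC n)
    rw [hmass] at hM'
    rw [(tsum_mul_exp_strictAnti hB hsum').injOn hA' hA (hM'.trans hAM.symm)]
  · obtain ⟨A₀, hA₀⟩ := hsecond A
    have hA_top : Tendsto (fun n : ℤ =>
        aF k γ ρ A n / ((Real.log 2)⁻¹ * (2:ℝ) ^ β * (2:ℝ) ^ ((β - α) * (ρ + 1)) *
          ((2:ℝ) ^ ((β - α) * (n:ℝ)) * Real.exp (-(A * (2:ℝ) ^ n))))) atTop (𝓝 1) := by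
      have hlim : Z⁻¹ * (2:ℝ) ^ (β - α) =
          (Real.log 2)⁻¹ * (2:ℝ) ^ β * (2:ℝ) ^ ((β - α) * (ρ + 1)) := by
        rw [hZdef, mul_inv, ← Real.rpow_neg zero_le_two, mul_assoc, mul_assoc,
          ← Real.rpow_add two_pos, ← Real.rpow_add two_pos]
        congr 2
        ring
      have h1 := (tendsto_aF_div_atTop hpos hZ htop A).div_const (Z⁻¹ * (2:ℝ) ^ (β - α))
      rw [div_self (by positivity), hlim] at h1
      exact h1.congr fun n => by rw [div_div, mul_comm]
    refine ⟨(A₀, A), ⟨hA, hA₀, hA_top⟩, ?_⟩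
    rintro ⟨p, q⟩ ⟨-, hp, hq⟩
    have h1 := eq_of_tendsto_second_order hcpos.ne' hp hA₀
    have h2 : q = A := by
      refine eq_of_tendsto_exp_rate (a := aF k γ ρ A) (P := fun n : ℤ => (Real.log 2)⁻¹ *
        (2:ℝ) ^ β * (2:ℝ) ^ ((β - α) * (ρ + 1)) * (2:ℝ) ^ ((β - α) * (n:ℝ)))
        (aF_pos hpos A) (fun n => by positivity) ?_ ?_
      · simpa only [mul_assoc] using hq
      · simpa only [mul_assoc] using hA_top
    exact Prod.ext h1 h2
end
end

section
/- There exists a constant C₂ > 0, depending only on M, such that: (i) for every y ∈ 𝒴_β and every A ≥ A_M/2 with A > 0, the sequence h(y,A) satisfies ‖h(y,A)‖_{β−1} ≤ C₂·‖y‖_β² + C₂·|A_M − A|·‖y‖_β; and (ii) for all y¹, y² ∈ 𝒴_β and all A¹, A² > A_M/2, ‖h(y¹,A¹) − h(y²,A²)‖_{β−1} ≤ C₂·‖y¹ − y²‖_β·(max{‖y¹‖_β, ‖y²‖_β} + |A_M − A¹|) + C₂·|A¹ − A²|·(‖y²‖_β² + ‖y²‖_β). -/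
open Filter Topology Asymptotics MeasureTheory

noncomputable section

/-- The norm `‖y‖_θ = sup_{n≤0} 2^n |y_n| + sup_{n>0} 2^{θn} |y_n|`, valued in `ℝ≥0∞`. -/
def Ynorm (θ : ℝ) (y : ℤ → ℝ) : ENNReal :=
  (⨆ n : {m : ℤ // m ≤ 0}, ENNReal.ofReal ((2:ℝ) ^ (n.1) * |y n.1|)) +
  ⨆ n : {m : ℤ // 0 < m}, ENNReal.ofReal ((2:ℝ) ^ (θ * (n.1:ℝ)) * |y n.1|)

/-- Membership in the space `𝒴_θ`. -/
def MemY (θ : ℝ) (y : ℤ → ℝ) : Prop := Ynorm θ y ≠ ⊤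

/-- The quadratic/remainder term
`h_n(y,A) = (2^n γ(2^n)/4)[¼ y_{n−1}² − 4 α_n(A)(γ(2^{n+1})/γ(2^n)) y_n²]
            + 2 γ(2^{n+1})(α_n(A_M) − α_n(A))(y_n − y_{n+1})`. -/
def hF (k γ : ℝ → ℝ) (A_M : ℝ) (y : ℤ → ℝ) (A : ℝ) (n : ℤ) : ℝ :=
  (2:ℝ) ^ n * γ ((2:ℝ) ^ n) / 4 *
      (1 / 4 * (y (n - 1)) ^ 2 -
        4 * alphaF k γ 0 A n * (γ ((2:ℝ) ^ (n + 1)) / γ ((2:ℝ) ^ n)) * (y n) ^ 2) +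
    2 * γ ((2:ℝ) ^ (n + 1)) * (alphaF k γ 0 A_M n - alphaF k γ 0 A n) * (y n - y (n + 1))

lemma exists_abs_le_of_tendsto {h : ℝ → ℝ} {a b : ℝ} (hc : ContinuousOn h (Set.Ioi 0))
    (h0 : Tendsto h (𝓝[>] 0) (𝓝 a)) (hinf : Tendsto h atTop (𝓝 b)) :
    ∃ L > 0, ∀ x : ℝ, 0 < x → |h x| ≤ L := by
  have e0 : ∀ᶠ x in 𝓝[>] (0:ℝ), |h x| ≤ |a| + 1 :=
    (h0.abs.eventually_lt_const (lt_add_one |a|)).mono fun _ hx => hx.le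
  have e1 : ∀ᶠ x in atTop, |h x| ≤ |b| + 1 :=
    (hinf.abs.eventually_lt_const (lt_add_one |b|)).mono fun _ hx => hx.le
  obtain ⟨δ, hδ, h0'⟩ := mem_nhdsGT_iff_exists_Ioc_subset.1 e0
  obtain ⟨R, hR⟩ := eventually_atTop.1 e1
  obtain ⟨K, hK⟩ := (isCompact_Icc (a := δ) (b := R)).exists_bound_of_continuousOn
    (hc.mono fun x hx => lt_of_lt_of_le hδ hx.1)
  refine ⟨|a| + |b| + |K| + 1, by positivity, fun x hx => ?_⟩
  have := abs_nonneg a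
  have := abs_nonneg b
  have := abs_nonneg K
  rcases le_total x δ with h1 | h1
  · have : |h x| ≤ |a| + 1 := h0' ⟨hx, h1⟩
    linarith
  rcases le_total R x with h2 | h2
  · linarith [hR x h2]
  · have := hK x ⟨h1, h2⟩
    rw [Real.norm_eq_abs] at this
    linarith [le_abs_self K]

/-- A positive continuous function on `(0,∞)` with positive limit at `0` and asymptotic to `x ^ p` at
infinity is comparable to `max 1 (x ^ p)`. -/
lemma exists_abs_log_sub_le {f : ℝ → ℝ} {f₀ p : ℝ} (hp : 0 < p) (hf₀ : 0 < f₀)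
    (hc : ContinuousOn f (Set.Ioi 0)) (hpos : ∀ x : ℝ, 0 < x → 0 < f x)
    (h0 : Tendsto f (𝓝[>] 0) (𝓝 f₀))
    (hinf : Tendsto (fun x : ℝ => f x / x ^ p) atTop (𝓝 1)) :
    ∃ L > 0, ∀ x : ℝ, 0 < x → |Real.log (f x) - Real.log (max 1 (x ^ p))| ≤ L := by
  have hm : ∀ x : ℝ, 0 < max 1 (x ^ p) := fun x => lt_max_of_lt_left one_pos
  refine exists_abs_le_of_tendsto (a := Real.log f₀) (b := Real.log 1) ?_ ?_ ?_
  · refine (hc.log fun x hx => (hpos x hx).ne').sub (ContinuousOn.log ?_ fun x _ => (hm x).ne')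
    exact continuousOn_const.sup
      (continuousOn_id.rpow_const fun x hx => Or.inl (ne_of_gt (Set.mem_Ioi.1 hx)))
  · refine (h0.log hf₀.ne').congr' ?_
    filter_upwards [Ioc_mem_nhdsGT (zero_lt_one' ℝ)] with x hx
    rw [max_eq_left (Real.rpow_le_one hx.1.le hx.2 hp.le), Real.log_one, sub_zero]
  · refine (hinf.log one_ne_zero).congr' ?_
    filter_upwards [eventually_ge_atTop (1:ℝ)] with x hx
    have hx0 : 0 < x := by linarith
    rw [max_eq_right (Real.one_le_rpow hx hp.le),
      Real.log_div (hpos x hx0).ne' (Real.rpow_pos_of_pos hx0 p).ne']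

lemma max_one_rpow_two_mul_le {p x : ℝ} (hp : 0 < p) (hx : 0 < x) :
    max 1 ((2 * x) ^ p) ≤ 2 ^ p * max 1 (x ^ p) := by
  have h2 : (1:ℝ) ≤ 2 ^ p := Real.one_le_rpow one_le_two hp.le
  rw [Real.mul_rpow zero_le_two hx.le]
  refine max_le ?_ ?_
  · exact one_le_mul_of_one_le_of_one_le h2 (le_max_left _ _)
  · exact mul_le_mul_of_nonneg_left (le_max_right _ _) (by positivity)

lemma max_one_rpow_le_two_mul {p x : ℝ} (hp : 0 < p) (hx : 0 < x) :
    max 1 (x ^ p) ≤ max 1 ((2 * x) ^ p) :=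
  max_le_max le_rfl (Real.rpow_le_rpow hx.le (by linarith) hp.le)

lemma exists_abs_log_two_mul_sub_le {f : ℝ → ℝ} {f₀ p : ℝ} (hp : 0 < p) (hf₀ : 0 < f₀)
    (hc : ContinuousOn f (Set.Ioi 0)) (hpos : ∀ x : ℝ, 0 < x → 0 < f x)
    (h0 : Tendsto f (𝓝[>] 0) (𝓝 f₀))
    (hinf : Tendsto (fun x : ℝ => f x / x ^ p) atTop (𝓝 1)) :
    ∃ L > 0, ∀ x : ℝ, 0 < x → |Real.log (f (2 * x)) - Real.log (f x)| ≤ L := by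
  obtain ⟨L, hL, h⟩ := exists_abs_log_sub_le hp hf₀ hc hpos h0 hinf
  have hlog2 : 0 < Real.log 2 := Real.log_pos one_lt_two
  refine ⟨2 * L + p * Real.log 2, by positivity, fun x hx => ?_⟩
  have hm : ∀ x : ℝ, 0 < max 1 (x ^ p) := fun x => lt_max_of_lt_left one_pos
  have h1 := abs_le.1 (h x hx)
  have h2 := abs_le.1 (h (2 * x) (by linarith))
  have h3 := Real.log_le_log (hm x) (max_one_rpow_le_two_mul hp hx)
  have h4 := Real.log_le_log (hm (2 * x)) (max_one_rpow_two_mul_le hp hx)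
  rw [Real.log_mul (by positivity) (hm x).ne', Real.log_rpow two_pos] at h4
  have : 0 < p * Real.log 2 := by positivity
  rw [abs_le]
  constructor <;> linarith [h1.1, h1.2, h2.1, h2.2]

lemma exists_le_mul_max_one_rpow {f : ℝ → ℝ} {f₀ p : ℝ} (hp : 0 < p) (hf₀ : 0 < f₀)
    (hc : ContinuousOn f (Set.Ioi 0)) (hpos : ∀ x : ℝ, 0 < x → 0 < f x)
    (h0 : Tendsto f (𝓝[>] 0) (𝓝 f₀))
    (hinf : Tendsto (fun x : ℝ => f x / x ^ p) atTop (𝓝 1)) :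
    ∃ C > 0, ∀ x : ℝ, 0 < x → f x ≤ C * max 1 (x ^ p) := by
  obtain ⟨L, hL, h⟩ := exists_abs_log_sub_le hp hf₀ hc hpos h0 hinf
  refine ⟨Real.exp L, Real.exp_pos L, fun x hx => ?_⟩
  have hm : 0 < max 1 (x ^ p) := lt_max_of_lt_left one_pos
  rw [← Real.log_le_log_iff (hpos x hx) (by positivity),
    Real.log_mul (Real.exp_pos L).ne' hm.ne', Real.log_exp]
  linarith [(abs_le.1 (h x hx)).2]

lemma tendsto_of_sub_isBigO_rpow {f : ℝ → ℝ} {f₀ q : ℝ} (hq : 0 < q)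
    (h : (fun x : ℝ => f x - f₀) =O[𝓝[>] 0] fun x : ℝ => x ^ q) :
    Tendsto f (𝓝[>] 0) (𝓝 f₀) := by
  have h1 : Tendsto (fun x : ℝ => x ^ q) (𝓝[>] 0) (𝓝 0) := by
    have := (Real.continuousAt_rpow_const 0 q (Or.inr hq.le)).tendsto
    rw [Real.zero_rpow hq.ne'] at this
    exact this.mono_left nhdsWithin_le_nhds
  simpa using (h.trans_tendsto h1).add_const f₀

lemma zeta_zero_eq (k γ : ℝ → ℝ) (n : ℤ) :
    zeta k γ 0 n = Real.log 2 * k ((2:ℝ) ^ n) / ((2:ℝ) ^ n * γ (2 * (2:ℝ) ^ n)) := by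
  simp only [zeta, add_zero]
  rw [Real.rpow_add_one two_ne_zero, Real.rpow_intCast, mul_comm ((2:ℝ) ^ n) 2]

lemma log_thetaF_zero {k γ : ℝ → ℝ} (hk : ∀ x : ℝ, 0 < x → 0 < k x)
    (hγ : ∀ x : ℝ, 0 < x → 0 < γ x) (n : ℤ) :
    Real.log (thetaF k γ 0 n) =
      (Real.log (k (2 * (2:ℝ) ^ n)) - Real.log (k ((2:ℝ) ^ n))) -
        (Real.log (γ (2 * (2 * (2:ℝ) ^ n))) - Real.log (γ (2 * (2:ℝ) ^ n))) := by
  have hx : (0:ℝ) < 2 ^ n := by positivity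
  have hlog2 : 0 < Real.log 2 := Real.log_pos one_lt_two
  have k1 := hk _ hx
  have k2 := hk (2 * 2 ^ n) (by positivity)
  have g1 := hγ (2 * 2 ^ n) (by positivity)
  have g2 := hγ (2 * (2 * 2 ^ n)) (by positivity)
  have : thetaF k γ 0 n = (k (2 * (2:ℝ) ^ n) / k ((2:ℝ) ^ n)) /
      (γ (2 * (2 * (2:ℝ) ^ n)) / γ (2 * (2:ℝ) ^ n)) := by
    rw [thetaF, zeta_zero_eq, zeta_zero_eq, zpow_add_one₀ two_ne_zero, mul_comm ((2:ℝ) ^ n) 2]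
    field_simp
  rw [this, Real.log_div (by positivity) (by positivity), Real.log_div k2.ne' k1.ne',
    Real.log_div g2.ne' g1.ne']

/-- The factor of `alphaF` that does not depend on `A`. -/
def alphaFactor (k γ : ℝ → ℝ) (n : ℤ) : ℝ :=
  Real.exp (-((2:ℝ) ^ n *
    ∑' m : ℕ, (2:ℝ) ^ (-(n + 1 + (m:ℤ))) * Real.log (thetaF k γ 0 (n + (m:ℤ)))))

lemma alphaF_zero_eq (k γ : ℝ → ℝ) (A : ℝ) (n : ℤ) :
    alphaF k γ 0 A n = Real.exp (-(A * (2:ℝ) ^ n)) * alphaFactor k γ n := rfl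

lemma alphaFactor_pos (k γ : ℝ → ℝ) (n : ℤ) : 0 < alphaFactor k γ n := Real.exp_pos _

lemma alphaFactor_le {k γ : ℝ → ℝ} {L : ℝ}
    (h : ∀ n : ℤ, |Real.log (thetaF k γ 0 n)| ≤ L) (n : ℤ) :
    alphaFactor k γ n ≤ Real.exp L := by
  rw [alphaFactor, Real.exp_le_exp]
  have hx : (0:ℝ) < 2 ^ n := by positivity
  have hs : HasSum (fun m : ℕ => (2:ℝ) ^ (-(n + 1 + (m:ℤ))) * L) (((2:ℝ) ^ n)⁻¹ * L) := by
    have e : (fun m : ℕ => (2:ℝ) ^ (-(n + 1 + (m:ℤ))) * L) =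
        fun m : ℕ => ((2:ℝ) ^ n)⁻¹ / 2 / 2 ^ m * L := by
      funext m
      rw [zpow_neg, zpow_add₀ two_ne_zero, zpow_add_one₀ two_ne_zero, zpow_natCast]
      field_simp
    rw [e]
    exact (hasSum_geometric_two' (((2:ℝ) ^ n)⁻¹)).mul_right L
  have hb := tsum_of_norm_bounded hs
    (f := fun m : ℕ => (2:ℝ) ^ (-(n + 1 + (m:ℤ))) * Real.log (thetaF k γ 0 (n + (m:ℤ))))
    (fun m => by
      have hpos : (0:ℝ) < 2 ^ (-(n + 1 + (m:ℤ))) := by positivity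
      rw [norm_mul, Real.norm_of_nonneg hpos.le, Real.norm_eq_abs]
      exact mul_le_mul_of_nonneg_left (h _) hpos.le)
  rw [Real.norm_eq_abs] at hb
  have := (abs_le.1 hb).1
  have h2 := mul_le_mul_of_nonneg_left this hx.le
  have h3 : (2:ℝ) ^ n * -(((2:ℝ) ^ n)⁻¹ * L) = -L := by field_simp
  linarith

/-- The weight defining `Ynorm`. -/
def Yweight (θ : ℝ) (n : ℤ) : ℝ := if n ≤ 0 then (2:ℝ) ^ n else (2:ℝ) ^ (θ * (n:ℝ))

lemma Yweight_pos (θ : ℝ) (n : ℤ) : 0 < Yweight θ n := by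
  unfold Yweight; split_ifs <;> positivity

lemma Yweight_mul_abs_le_toReal {θ : ℝ} {y : ℤ → ℝ} (hy : MemY θ y) (n : ℤ) :
    Yweight θ n * |y n| ≤ (Ynorm θ y).toReal := by
  refine (ENNReal.ofReal_le_iff_le_toReal hy).1 ?_
  unfold Yweight Ynorm
  split_ifs with hn
  · exact (le_iSup (fun m : {m : ℤ // m ≤ 0} => ENNReal.ofReal ((2:ℝ) ^ (m.1) * |y m.1|))
      ⟨n, hn⟩).trans le_self_add
  · exact (le_iSup (fun m : {m : ℤ // 0 < m} =>
      ENNReal.ofReal ((2:ℝ) ^ (θ * (m.1:ℝ)) * |y m.1|)) ⟨n, not_le.1 hn⟩).trans le_add_self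

lemma Ynorm_le_of_forall {θ K : ℝ} {y : ℤ → ℝ} (h : ∀ n, Yweight θ n * |y n| ≤ K) :
    Ynorm θ y ≤ ENNReal.ofReal (2 * K) := by
  have hK : 0 ≤ K := (mul_nonneg (Yweight_pos θ 0).le (abs_nonneg _)).trans (h 0)
  rw [two_mul, ENNReal.ofReal_add hK hK]
  refine add_le_add (iSup_le fun n => ?_) (iSup_le fun n => ?_) <;>
    refine ENNReal.ofReal_le_ofReal ?_
  · simpa [Yweight, n.2] using h n.1
  · simpa [Yweight, not_le.2 n.2] using h n.1

lemma MemY.sub {θ : ℝ} {y z : ℤ → ℝ} (hy : MemY θ y) (hz : MemY θ z) :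
    MemY θ (fun n => y n - z n) := by
  refine ne_top_of_le_ne_top ENNReal.ofReal_ne_top (Ynorm_le_of_forall
    (K := (Ynorm θ y).toReal + (Ynorm θ z).toReal) fun n => ?_)
  have h1 := Yweight_mul_abs_le_toReal hy n
  have h2 := Yweight_mul_abs_le_toReal hz n
  have h3 := mul_le_mul_of_nonneg_left (abs_sub (y n) (z n)) (Yweight_pos θ n).le
  linarith

lemma Yweight_eq_max {β : ℝ} (hβ : 1 < β) (n : ℤ) :
    Yweight β n = max ((2:ℝ) ^ n) (((2:ℝ) ^ n) ^ β) := by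
  have hx : (0:ℝ) < 2 ^ n := by positivity
  have hr : (2:ℝ) ^ (β * (n:ℝ)) = ((2:ℝ) ^ n) ^ β := by
    rw [mul_comm, Real.rpow_mul zero_le_two, Real.rpow_intCast]
  unfold Yweight
  split_ifs with hn
  · refine (max_eq_left ?_).symm
    have := Real.rpow_le_rpow_of_exponent_ge hx (zpow_le_one_of_nonpos₀ one_le_two hn) hβ.le
    rwa [Real.rpow_one] at this
  · rw [hr]
    refine (max_eq_right ?_).symm
    have := Real.rpow_le_rpow_of_exponent_le
      (one_le_zpow₀ (one_le_two (α := ℝ)) (not_le.1 hn).le) hβ.le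
    rwa [Real.rpow_one] at this

lemma Yweight_sub_one_eq_min {β : ℝ} (hβ : β < 2) (n : ℤ) :
    Yweight (β - 1) n = min ((2:ℝ) ^ n) (((2:ℝ) ^ n) ^ (β - 1)) := by
  have hx : (0:ℝ) < 2 ^ n := by positivity
  have hr : (2:ℝ) ^ ((β - 1) * (n:ℝ)) = ((2:ℝ) ^ n) ^ (β - 1) := by
    rw [mul_comm, Real.rpow_mul zero_le_two, Real.rpow_intCast]
  unfold Yweight
  split_ifs with hn
  · refine (min_eq_left ?_).symm
    have := Real.rpow_le_rpow_of_exponent_ge hx (zpow_le_one_of_nonpos₀ one_le_two hn)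
      (show β - 1 ≤ 1 by linarith)
    rwa [Real.rpow_one] at this
  · rw [hr]
    refine (min_eq_right ?_).symm
    have := Real.rpow_le_rpow_of_exponent_le
      (one_le_zpow₀ (one_le_two (α := ℝ)) (not_le.1 hn).le) (show β - 1 ≤ 1 by linarith)
    rwa [Real.rpow_one] at this

lemma Yweight_le_four_mul {β : ℝ} (hβ : β ∈ Set.Ioo (1:ℝ) 2) (n : ℤ) :
    Yweight β n ≤ 4 * Yweight β (n - 1) := by
  rw [Yweight_eq_max hβ.1, Yweight_eq_max hβ.1]
  have hx : (0:ℝ) < 2 ^ (n - 1) := by positivity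
  have h : (2:ℝ) ^ n = 2 * 2 ^ (n - 1) := by
    rw [zpow_sub_one₀ two_ne_zero]; field_simp
  have h4 : (2:ℝ) ^ β ≤ 4 := by
    have := Real.rpow_le_rpow_of_exponent_le one_le_two hβ.2.le
    norm_num at this ⊢
    exact this
  rw [h, Real.mul_rpow zero_le_two hx.le]
  have h1 := le_max_left ((2:ℝ) ^ (n - 1)) ((2 ^ (n - 1)) ^ β)
  have h2 := le_max_right ((2:ℝ) ^ (n - 1)) ((2 ^ (n - 1)) ^ β)
  refine max_le (by linarith) ?_
  have := mul_le_mul_of_nonneg_right h4 (Real.rpow_nonneg hx.le β)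
  linarith

lemma Yweight_le_succ {β : ℝ} (hβ : 1 < β) (n : ℤ) :
    Yweight β n ≤ Yweight β (n + 1) := by
  rw [Yweight_eq_max hβ, Yweight_eq_max hβ]
  have hx : (0:ℝ) < 2 ^ n := by positivity
  have h : (2:ℝ) ^ n ≤ 2 ^ (n + 1) := zpow_le_zpow_right₀ one_le_two (by lia)
  exact max_le_max h (Real.rpow_le_rpow hx.le h (by linarith))

lemma Yweight_mul_max_le_sq {β : ℝ} (hβ : β ∈ Set.Ioo (1:ℝ) 2) (n : ℤ) :
    Yweight (β - 1) n * (2 ^ n * max 1 (((2:ℝ) ^ n) ^ β)) ≤ Yweight β n ^ 2 := by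
  rw [Yweight_eq_max hβ.1, Yweight_sub_one_eq_min hβ.2]
  have hx : (0:ℝ) < 2 ^ n := by positivity
  set x : ℝ := 2 ^ n
  have hb : 0 < x ^ β := by positivity
  have hu : 0 < min x (x ^ (β - 1)) := by positivity
  have h1 : min x (x ^ (β - 1)) * x ≤ x ^ β := by
    calc _ ≤ x ^ (β - 1) * x := mul_le_mul_of_nonneg_right (min_le_right _ _) hx.le
      _ = x ^ β := by rw [← Real.rpow_add_one hx.ne']; ring_nf
  rw [← mul_assoc, mul_max_of_nonneg _ _ (by positivity), mul_one]
  refine max_le ?_ ?_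
  · calc _ ≤ x * x := mul_le_mul_of_nonneg_right (min_le_left _ _) hx.le
      _ ≤ _ := by rw [sq]; gcongr <;> exact le_max_left _ _
  · calc _ ≤ x ^ β * x ^ β := mul_le_mul_of_nonneg_right h1 hb.le
      _ ≤ _ := by rw [sq]; gcongr <;> exact le_max_right _ _

lemma exists_rpow_mul_exp_neg_le (s : ℝ) {c : ℝ} (hs : 0 < s) (hc : 0 < c) :
    ∃ E > 0, ∀ x : ℝ, 0 < x → x ^ s * Real.exp (-(c * x)) ≤ E := by
  have hcont : ContinuousOn (fun x : ℝ => x ^ s * Real.exp (-(c * x))) (Set.Ioi 0) :=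
    (continuousOn_id.rpow_const fun x hx => Or.inl (ne_of_gt (Set.mem_Ioi.1 hx))).mul
      (by fun_prop)
  have h0 : Tendsto (fun x : ℝ => x ^ s * Real.exp (-(c * x))) (𝓝[>] 0) (𝓝 0) := by
    have h : ContinuousAt (fun x : ℝ => x ^ s * Real.exp (-(c * x))) 0 :=
      (Real.continuousAt_rpow_const 0 s (Or.inr hs.le)).mul (by fun_prop)
    have := h.tendsto
    rw [Real.zero_rpow hs.ne', zero_mul] at this
    exact this.mono_left nhdsWithin_le_nhds
  have hinf : Tendsto (fun x : ℝ => x ^ s * Real.exp (-(c * x))) atTop (𝓝 0) := by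
    simpa only [neg_mul] using tendsto_rpow_mul_exp_neg_mul_atTop_nhds_zero s c hc
  obtain ⟨E, hE, h⟩ := exists_abs_le_of_tendsto hcont h0 hinf
  exact ⟨E, hE, fun x hx => (le_abs_self _).trans (h x hx)⟩

lemma exists_Yweight_mul_max_mul_exp_le {β c : ℝ} (hβ : β ∈ Set.Ioo (1:ℝ) 2) (hc : 0 < c) :
    ∃ E > 0, ∀ n : ℤ, Yweight (β - 1) n *
      (max 1 (((2:ℝ) ^ n) ^ β) * (2 ^ n * Real.exp (-(c * 2 ^ n)))) ≤ E * Yweight β n := by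
  obtain ⟨E₁, hE₁, h₁⟩ := exists_rpow_mul_exp_neg_le 1 one_pos hc
  obtain ⟨E₂, hE₂, h₂⟩ := exists_rpow_mul_exp_neg_le β (by linarith [hβ.1]) hc
  refine ⟨E₁ + E₂, by positivity, fun n => ?_⟩
  rw [Yweight_eq_max hβ.1, Yweight_sub_one_eq_min hβ.2]
  have hx : (0:ℝ) < 2 ^ n := by positivity
  set x : ℝ := 2 ^ n
  have h₁ := h₁ x hx
  have h₂ := h₂ x hx
  rw [Real.rpow_one] at h₁
  have hb : 0 < x ^ β := by positivity
  have he := Real.exp_pos (-(c * x))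
  set e := Real.exp (-(c * x))
  have hu : 0 < min x (x ^ (β - 1)) := by positivity
  have h3 : min x (x ^ (β - 1)) * x ≤ x ^ β := by
    calc _ ≤ x ^ (β - 1) * x := mul_le_mul_of_nonneg_right (min_le_right _ _) hx.le
      _ = x ^ β := by rw [← Real.rpow_add_one hx.ne']; ring_nf
  have hm : 0 < max x (x ^ β) := by positivity
  rw [max_mul_of_nonneg _ _ (by positivity), mul_max_of_nonneg _ _ hu.le]
  refine max_le ?_ ?_
  · calc _ ≤ x * (1 * (x * e)) := mul_le_mul_of_nonneg_right (min_le_left _ _) (by positivity)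
      _ = x * e * x := by ring
      _ ≤ (E₁ + E₂) * max x (x ^ β) := by
        gcongr
        · linarith
        · exact le_max_left _ _
  · calc _ = min x (x ^ (β - 1)) * x * (x ^ β * e) := by ring
      _ ≤ x ^ β * (E₁ + E₂) := by
        gcongr
        linarith
      _ ≤ max x (x ^ β) * (E₁ + E₂) := by
        gcongr
        exact le_max_right _ _
      _ = _ := mul_comm _ _

lemma abs_exp_neg_sub_exp_neg_le {a b c : ℝ} (ha : c ≤ a) (hb : c ≤ b) :
    |Real.exp (-a) - Real.exp (-b)| ≤ |a - b| * Real.exp (-c) := by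
  wlog hab : a ≤ b generalizing a b
  · rw [abs_sub_comm, abs_sub_comm a]
    exact this hb ha (le_of_not_ge hab)
  rw [abs_of_nonneg (sub_nonneg.2 (Real.exp_le_exp.2 (neg_le_neg hab))), abs_sub_comm,
    abs_of_nonneg (sub_nonneg.2 hab)]
  have h1 := Real.add_one_le_exp (a - b)
  have h2 : Real.exp (-b) = Real.exp (-a) * Real.exp (a - b) := by
    rw [← Real.exp_add]; ring_nf
  have h3 : Real.exp (-a) ≤ Real.exp (-c) := Real.exp_le_exp.2 (neg_le_neg ha)
  have h4 := Real.exp_pos (-a)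
  calc _ = Real.exp (-a) * (1 - Real.exp (a - b)) := by rw [h2]; ring
    _ ≤ Real.exp (-a) * (b - a) := mul_le_mul_of_nonneg_left (by linarith) h4.le
    _ ≤ Real.exp (-c) * (b - a) := mul_le_mul_of_nonneg_right h3 (by linarith)
    _ = _ := mul_comm _ _

lemma abs_alphaF_sub_le {k γ : ℝ → ℝ} {B c A A' : ℝ} {n : ℤ} (hB : alphaFactor k γ n ≤ B)
    (hA : c ≤ A) (hA' : c ≤ A') :
    |alphaF k γ 0 A n - alphaF k γ 0 A' n| ≤
      B * |A - A'| * (2 ^ n * Real.exp (-(c * 2 ^ n))) := by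
  have hx : (0:ℝ) < 2 ^ n := by positivity
  have hα := alphaFactor_pos k γ n
  have h := abs_exp_neg_sub_exp_neg_le (mul_le_mul_of_nonneg_right hA hx.le)
    (mul_le_mul_of_nonneg_right hA' hx.le)
  rw [← sub_mul, abs_mul, abs_of_pos hx] at h
  rw [alphaF_zero_eq, alphaF_zero_eq, ← sub_mul, abs_mul, abs_of_pos hα]
  calc _ ≤ |A - A'| * 2 ^ n * Real.exp (-(c * 2 ^ n)) * B := by gcongr
    _ = _ := by ring

lemma alphaF_le {k γ : ℝ → ℝ} {B A : ℝ} {n : ℤ} (hB : alphaFactor k γ n ≤ B) (hA : 0 ≤ A) :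
    alphaF k γ 0 A n ≤ B := by
  have hα := alphaFactor_pos k γ n
  rw [alphaF_zero_eq]
  have : Real.exp (-(A * 2 ^ n)) ≤ 1 := Real.exp_le_one_iff.2 (by
    have : 0 ≤ A * (2:ℝ) ^ n := by positivity
    linarith)
  nlinarith

lemma hF_eq {γ : ℝ → ℝ} (k : ℝ → ℝ) (hγ : ∀ x : ℝ, 0 < x → 0 < γ x) (A_M : ℝ) (y : ℤ → ℝ)
    (A : ℝ) (n : ℤ) :
    hF k γ A_M y A n = 2 ^ n * γ (2 ^ n) / 16 * y (n - 1) ^ 2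
      - 2 ^ n * γ (2 ^ (n + 1)) * alphaF k γ 0 A n * y n ^ 2
      + 2 * γ (2 ^ (n + 1)) * (alphaF k γ 0 A_M n - alphaF k γ 0 A n) * (y n - y (n + 1)) := by
  have := (hγ ((2:ℝ) ^ n) (by positivity)).ne'
  rw [hF]
  field_simp
  ring

lemma mul_mul_abs_mul_abs_le {u v P C p q s t : ℝ} (hv : 0 ≤ v) (hC : 0 ≤ C)
    (h : u * P ≤ C * v ^ 2) (hp : v * |p| ≤ s) (hq : v * |q| ≤ t) :
    u * (P * (|p| * |q|)) ≤ C * (s * t) := by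
  have h0 := abs_nonneg p
  have h1 := abs_nonneg q
  calc _ = u * P * (|p| * |q|) := by ring
    _ ≤ C * v ^ 2 * (|p| * |q|) := by gcongr
    _ = C * ((v * |p|) * (v * |q|)) := by ring
    _ ≤ _ := by
      have : 0 ≤ s := (by positivity : 0 ≤ v * |p|).trans hp
      gcongr

lemma mul_mul_abs_le {u v R C p s : ℝ} (hC : 0 ≤ C)
    (h : u * R ≤ C * v) (hp : v * |p| ≤ s) :
    u * (R * |p|) ≤ C * s := by
  calc _ = u * R * |p| := by ring
    _ ≤ C * v * |p| := mul_le_mul_of_nonneg_right h (abs_nonneg p)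
    _ = C * (v * |p|) := by ring
    _ ≤ _ := mul_le_mul_of_nonneg_left hp hC

lemma exists_coefficient_bounds {k γ : ℝ → ℝ} {β B K c : ℝ} (hβ : β ∈ Set.Ioo (1:ℝ) 2)
    (hc : 0 < c) (hγ_pos : ∀ x : ℝ, 0 < x → 0 < γ x)
    (hK : 0 < K) (hγ : ∀ x : ℝ, 0 < x → γ x ≤ K * max 1 (x ^ β))
    (hB : ∀ n, alphaFactor k γ n ≤ B) :
    ∃ C > 0, ∀ n : ℤ,
      Yweight (β - 1) n * (2 ^ n * γ (2 ^ n)) ≤ C * Yweight β n ^ 2 ∧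
      (∀ A, c ≤ A → Yweight (β - 1) n * (2 ^ n * γ (2 ^ (n + 1)) * alphaF k γ 0 A n) ≤
        C * Yweight β n ^ 2) ∧
      (∀ A A', c ≤ A → c ≤ A' → Yweight (β - 1) n *
        (2 ^ n * γ (2 ^ (n + 1)) * |alphaF k γ 0 A n - alphaF k γ 0 A' n|) ≤
          C * |A - A'| * Yweight β n ^ 2) ∧
      (∀ A A', c ≤ A → c ≤ A' → Yweight (β - 1) n *
        (γ (2 ^ (n + 1)) * |alphaF k γ 0 A n - alphaF k γ 0 A' n|) ≤
          C * |A - A'| * Yweight β n) := by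
  obtain ⟨E, hE, hE'⟩ := exists_Yweight_mul_max_mul_exp_le hβ hc
  obtain ⟨F, hF, hF'⟩ := exists_rpow_mul_exp_neg_le 1 one_pos hc
  have hB0 : 0 < B := (alphaFactor_pos k γ 0).trans_le (hB 0)
  obtain ⟨C, hC⟩ : ∃ C, C = K + 2 ^ β * K * B + 2 ^ β * K * (B * F) + 2 ^ β * K * B * E := ⟨_, rfl⟩
  have hβ2 : (0:ℝ) < 2 ^ β := by positivity
  have c1 : 0 < 2 ^ β * K * B := by positivity
  have c2 : 0 < 2 ^ β * K * (B * F) := by positivity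
  have c3 : 0 < 2 ^ β * K * B * E := by positivity
  refine ⟨C, by linarith, fun n => ?_⟩
  have hx : (0:ℝ) < 2 ^ n := by positivity
  have hxx : (2:ℝ) ^ (n + 1) = 2 * 2 ^ n := by rw [zpow_add_one₀ two_ne_zero, mul_comm]
  have hw := Yweight_mul_max_le_sq hβ n
  have hE' := hE' n
  have hF' := hF' _ hx
  have hB := hB n
  have hu := Yweight_pos (β - 1) n
  have hv := Yweight_pos β n
  have hγ1 := hγ _ hx
  have hγ2 : γ (2 ^ (n + 1)) ≤ 2 ^ β * K * max 1 (((2:ℝ) ^ n) ^ β) := by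
    rw [hxx]
    refine (hγ _ (by positivity)).trans ?_
    have := mul_le_mul_of_nonneg_left
      (max_one_rpow_two_mul_le (p := β) (by linarith [hβ.1]) hx) hK.le
    linarith
  have hγ2pos := hγ_pos (2 ^ (n + 1)) (by positivity)
  rw [Real.rpow_one] at hF'
  set x : ℝ := 2 ^ n
  set m := max 1 (x ^ β)
  set g := γ (2 ^ (n + 1))
  set u := Yweight (β - 1) n
  set v := Yweight β n
  have hm : 0 < m := lt_max_of_lt_left one_pos
  have hQ : u * (x * g) ≤ 2 ^ β * K * v ^ 2 := by
    calc _ ≤ u * (x * (2 ^ β * K * m)) := by gcongr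
      _ = 2 ^ β * K * (u * (x * m)) := by ring
      _ ≤ _ := by gcongr
  refine ⟨?_, fun A hA => ?_, fun A A' hA hA' => ?_, fun A A' hA hA' => ?_⟩
  · calc _ ≤ u * (x * (K * m)) := by gcongr
      _ = K * (u * (x * m)) := by ring
      _ ≤ K * v ^ 2 := by gcongr
      _ ≤ _ := by gcongr; linarith
  · calc _ = u * (x * g) * alphaF k γ 0 A n := by ring
      _ ≤ u * (x * g) * B := by
        have := alphaF_le hB (hc.le.trans hA)
        gcongr
      _ ≤ 2 ^ β * K * v ^ 2 * B := by gcongr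
      _ = 2 ^ β * K * B * v ^ 2 := by ring
      _ ≤ _ := by gcongr; linarith
  · calc _ = u * (x * g) * |alphaF k γ 0 A n - alphaF k γ 0 A' n| := by ring
      _ ≤ 2 ^ β * K * v ^ 2 * (B * |A - A'| * F) := by
        have := abs_alphaF_sub_le hB hA hA'
        gcongr
        exact this.trans (by gcongr)
      _ = 2 ^ β * K * (B * F) * |A - A'| * v ^ 2 := by ring
      _ ≤ _ := by gcongr; linarith
  · calc _ ≤ u * (2 ^ β * K * m * (B * |A - A'| * (x * Real.exp (-(c * x))))) := by
          have := abs_alphaF_sub_le hB hA hA'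
          gcongr
      _ = 2 ^ β * K * B * |A - A'| * (u * (m * (x * Real.exp (-(c * x))))) := by ring
      _ ≤ 2 ^ β * K * B * |A - A'| * (E * v) := by gcongr
      _ = 2 ^ β * K * B * E * |A - A'| * v := by ring
      _ ≤ _ := by gcongr; linarith

/-- Pointwise Lipschitz estimate for `hF`, given weighted bounds on its coefficients. -/
lemma Yweight_mul_abs_hF_sub_le {k γ : ℝ → ℝ} {β A_M c C : ℝ} (hβ : β ∈ Set.Ioo (1:ℝ) 2)
    (hcM : c ≤ A_M) (hγ_pos : ∀ x : ℝ, 0 < x → 0 < γ x) (hC : 0 < C) {n : ℤ}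
    (h₁ : Yweight (β - 1) n * (2 ^ n * γ (2 ^ n)) ≤ C * Yweight β n ^ 2)
    (h₂ : ∀ A, c ≤ A → Yweight (β - 1) n * (2 ^ n * γ (2 ^ (n + 1)) * alphaF k γ 0 A n) ≤
        C * Yweight β n ^ 2)
    (h₃ : ∀ A A', c ≤ A → c ≤ A' → Yweight (β - 1) n *
        (2 ^ n * γ (2 ^ (n + 1)) * |alphaF k γ 0 A n - alphaF k γ 0 A' n|) ≤
          C * |A - A'| * Yweight β n ^ 2)
    (h₄ : ∀ A A', c ≤ A → c ≤ A' → Yweight (β - 1) n *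
        (γ (2 ^ (n + 1)) * |alphaF k γ 0 A n - alphaF k γ 0 A' n|) ≤
          C * |A - A'| * Yweight β n)
    {y₁ y₂ : ℤ → ℝ} {N N₂ D : ℝ} (hN₁ : ∀ m, Yweight β m * |y₁ m| ≤ N)
    (hN : ∀ m, Yweight β m * |y₂ m| ≤ N) (hN₂ : ∀ m, Yweight β m * |y₂ m| ≤ N₂)
    (hD : ∀ m, Yweight β m * |y₁ m - y₂ m| ≤ D)
    {A₁ A₂ : ℝ} (hA₁ : c ≤ A₁) (hA₂ : c ≤ A₂) :
    Yweight (β - 1) n * |hF k γ A_M y₁ A₁ n - hF k γ A_M y₂ A₂ n| ≤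
      4 * C * (D * (N + |A_M - A₁|) + |A₁ - A₂| * (N₂ ^ 2 + N₂)) := by
  have hu := Yweight_pos (β - 1) n
  have hv := Yweight_pos β n
  have hx : (0:ℝ) < 2 ^ n := by positivity
  have hprev : ∀ {z : ℤ → ℝ} {S : ℝ}, (∀ m, Yweight β m * |z m| ≤ S) →
      Yweight β n * |z (n - 1)| ≤ 4 * S := fun {z S} h => by
    have := mul_le_mul_of_nonneg_right (Yweight_le_four_mul hβ n) (abs_nonneg (z (n - 1)))
    linarith [h (n - 1)]
  have hnext : ∀ {z : ℤ → ℝ} {S : ℝ}, (∀ m, Yweight β m * |z m| ≤ S) →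
      Yweight β n * |z n - z (n + 1)| ≤ 2 * S := fun {z S} h => by
    have := mul_le_mul_of_nonneg_right (Yweight_le_succ hβ.1 n) (abs_nonneg (z (n + 1)))
    have := mul_le_mul_of_nonneg_left (abs_sub (z n) (z (n + 1))) hv.le
    linarith [h n, h (n + 1)]
  have hS : ∀ m, Yweight β m * |y₁ m + y₂ m| ≤ 2 * N := fun m => by
    have := mul_le_mul_of_nonneg_left (abs_add_le (y₁ m) (y₂ m)) (Yweight_pos β m).le
    linarith [hN₁ m, hN m]
  have g1 := hγ_pos (2 ^ n) hx
  have g2 := hγ_pos (2 ^ (n + 1)) (by positivity)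
  have hα : 0 < alphaF k γ 0 A₁ n := mul_pos (Real.exp_pos _) (Real.exp_pos _)
  have e₁ := mul_mul_abs_mul_abs_le hv.le hC.le h₁ (hprev hD) (hprev hS)
  have e₂ := mul_mul_abs_mul_abs_le hv.le hC.le (h₂ A₁ hA₁) (hD n) (hS n)
  have e₃ := mul_mul_abs_mul_abs_le hv.le (by positivity) (h₃ A₁ A₂ hA₁ hA₂) (hN₂ n) (hN₂ n)
  have e₄ := mul_mul_abs_le (by positivity) (h₄ A_M A₁ hcM hA₁)
    (hnext (z := fun m => y₁ m - y₂ m) hD)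
  have e₅ := mul_mul_abs_le (by positivity) (h₄ A₁ A₂ hA₁ hA₂) (hnext hN₂)
  rw [hF_eq k hγ_pos, hF_eq k hγ_pos]
  set P := 2 ^ n * γ (2 ^ n)
  set g := γ (2 ^ (n + 1))
  set a₁ := alphaF k γ 0 A₁ n
  set a₂ := alphaF k γ 0 A₂ n
  set aM := alphaF k γ 0 A_M n
  set u := Yweight (β - 1) n
  set x : ℝ := 2 ^ n
  have hP : 0 < P := mul_pos hx g1
  have key : P / 16 * y₁ (n - 1) ^ 2 - x * g * a₁ * y₁ n ^ 2
        + 2 * g * (aM - a₁) * (y₁ n - y₁ (n + 1))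
      - (P / 16 * y₂ (n - 1) ^ 2 - x * g * a₂ * y₂ n ^ 2
        + 2 * g * (aM - a₂) * (y₂ n - y₂ (n + 1))) =
      P * ((y₁ (n - 1) - y₂ (n - 1)) * (y₁ (n - 1) + y₂ (n - 1))) / 16
      + -(x * g * a₁ * ((y₁ n - y₂ n) * (y₁ n + y₂ n)))
      + -(x * g * (a₁ - a₂) * (y₂ n * y₂ n))
      + 2 * (g * (aM - a₁) * (y₁ n - y₂ n - (y₁ (n + 1) - y₂ (n + 1))))
      + -(2 * (g * (a₁ - a₂) * (y₂ n - y₂ (n + 1)))) := by ring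
  have habs : |P / 16 * y₁ (n - 1) ^ 2 - x * g * a₁ * y₁ n ^ 2
        + 2 * g * (aM - a₁) * (y₁ n - y₁ (n + 1))
      - (P / 16 * y₂ (n - 1) ^ 2 - x * g * a₂ * y₂ n ^ 2
        + 2 * g * (aM - a₂) * (y₂ n - y₂ (n + 1)))| ≤
      P * (|y₁ (n - 1) - y₂ (n - 1)| * |y₁ (n - 1) + y₂ (n - 1)|) / 16
      + x * g * a₁ * (|y₁ n - y₂ n| * |y₁ n + y₂ n|)
      + x * g * |a₁ - a₂| * (|y₂ n| * |y₂ n|)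
      + 2 * (g * |aM - a₁| * |y₁ n - y₂ n - (y₁ (n + 1) - y₂ (n + 1))|)
      + 2 * (g * |a₁ - a₂| * |y₂ n - y₂ (n + 1)|) := by
    rw [key]
    refine (abs_add_le _ _).trans (add_le_add ((abs_add_le _ _).trans (add_le_add
      ((abs_add_le _ _).trans (add_le_add ((abs_add_le _ _).trans (add_le_add ?_ ?_)) ?_)) ?_)) ?_)
    all_goals
      simp only [abs_neg, abs_mul, abs_div, abs_of_pos hP, abs_of_pos hx, abs_of_pos g2,
        abs_of_pos hα, Nat.abs_ofNat, le_refl]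
  have := mul_le_mul_of_nonneg_left habs hu.le
  have hN₂0 : 0 ≤ C * |A₁ - A₂| * (N₂ * N₂) :=
    mul_nonneg (by positivity) (mul_self_nonneg _)
  linarith

/-- The Lipschitz estimate for `hF` in the weighted norms. -/
lemma exists_Ynorm_hF_sub_le {k γ : ℝ → ℝ} {β A_M c B K : ℝ} (hβ : β ∈ Set.Ioo (1:ℝ) 2)
    (hc : 0 < c) (hcM : c ≤ A_M) (hγ_pos : ∀ x : ℝ, 0 < x → 0 < γ x)
    (hK : 0 < K) (hγ : ∀ x : ℝ, 0 < x → γ x ≤ K * max 1 (x ^ β))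
    (hB : ∀ n, alphaFactor k γ n ≤ B) :
    ∃ C > 0, ∀ y₁ y₂ : ℤ → ℝ, MemY β y₁ → MemY β y₂ → ∀ A₁ A₂ : ℝ, c ≤ A₁ → c ≤ A₂ →
      Ynorm (β - 1) (fun n => hF k γ A_M y₁ A₁ n - hF k γ A_M y₂ A₂ n) ≤
          ENNReal.ofReal C * Ynorm β (fun n => y₁ n - y₂ n) *
              (max (Ynorm β y₁) (Ynorm β y₂) + ENNReal.ofReal |A_M - A₁|) +
            ENNReal.ofReal C * ENNReal.ofReal |A₁ - A₂| *
              ((Ynorm β y₂) ^ 2 + Ynorm β y₂) := by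
  obtain ⟨C, hC, h⟩ := exists_coefficient_bounds hβ hc hγ_pos hK hγ hB
  refine ⟨8 * C, by positivity, fun y₁ y₂ hy₁ hy₂ A₁ A₂ hA₁ hA₂ => ?_⟩
  have hd := hy₁.sub hy₂
  have hbound := Ynorm_le_of_forall fun n => Yweight_mul_abs_hF_sub_le hβ hcM hγ_pos hC
    (h n).1 (h n).2.1 (h n).2.2.1 (h n).2.2.2
    (fun m => (Yweight_mul_abs_le_toReal hy₁ m).trans (le_max_left _ (Ynorm β y₂).toReal))
    (fun m => (Yweight_mul_abs_le_toReal hy₂ m).trans (le_max_right (Ynorm β y₁).toReal _))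
    (Yweight_mul_abs_le_toReal hy₂) (Yweight_mul_abs_le_toReal hd) hA₁ hA₂
  refine hbound.trans (le_of_eq ?_)
  rw [← ENNReal.ofReal_toReal hd, ← ENNReal.ofReal_toReal hy₁, ← ENNReal.ofReal_toReal hy₂]
  set N₁ := (Ynorm β y₁).toReal
  set N₂ := (Ynorm β y₂).toReal
  set D := (Ynorm β fun n => y₁ n - y₂ n).toReal
  have hN₁ : 0 ≤ N₁ := ENNReal.toReal_nonneg
  have hN₂ : 0 ≤ N₂ := ENNReal.toReal_nonneg
  have hD : 0 ≤ D := ENNReal.toReal_nonneg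
  rw [← ENNReal.ofReal_max, ← ENNReal.ofReal_pow hN₂, ← ENNReal.ofReal_add (by positivity)
    (by positivity), ← ENNReal.ofReal_add (by positivity) (by positivity),
    ← ENNReal.ofReal_mul (by positivity), ← ENNReal.ofReal_mul (by positivity),
    ← ENNReal.ofReal_mul (by positivity), ← ENNReal.ofReal_mul (by positivity),
    ← ENNReal.ofReal_add (by positivity) (by positivity)]
  congr 1
  simp only [ENNReal.toReal_ofReal hN₁, ENNReal.toReal_ofReal hN₂, ENNReal.toReal_ofReal hD]
  ring

/-- estimates for the nonlinear term `h`.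
There is `C₂ > 0`, depending only on `M`, such that `‖h(y,A)‖_{β−1} ≤ C₂‖y‖_β² + C₂|A_M−A|‖y‖_β`
for `A ≥ A_M/2`, together with the corresponding Lipschitz estimate. -/
theorem stmt15
    (α β αb βb k₀ γ₀ : ℝ)
    (hα : α ∈ Set.Ioo (0:ℝ) 1) (hβ : β ∈ Set.Ioo (1:ℝ) 2)
    (hαb : 1 < αb) (hβb : 1 < βb) (hk₀ : 0 < k₀) (hγ₀ : 0 < γ₀)
    (k γ : ℝ → ℝ)
    (hk_cont : ContinuousOn k (Set.Ici 0)) (hk_pos : ∀ ξ : ℝ, 0 ≤ ξ → 0 < k ξ)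
    (hk_inf : Tendsto (fun ξ : ℝ => k ξ / ξ ^ (α + 1)) atTop (𝓝 1))
    (hk_0 : (fun ξ : ℝ => k ξ - k₀) =O[𝓝[>] 0] fun ξ : ℝ => ξ ^ αb)
    (hγ_cont : ContinuousOn γ (Set.Ioi 0)) (hγ_pos : ∀ ξ : ℝ, 0 < ξ → 0 < γ ξ)
    (hγ_inf : Tendsto (fun ξ : ℝ => γ ξ / ξ ^ β) atTop (𝓝 1))
    (hγ_0 : (fun ξ : ℝ => γ ξ - γ₀) =O[𝓝[>] 0] fun ξ : ℝ => ξ ^ βb)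
    (M : ℝ) (hM : 0 < M) (A_M : ℝ) (hAM_pos : 0 < A_M)
    (hAM_sum : Summable (fun n : ℤ => (2:ℝ) ^ n * aF k γ 0 A_M n))
    (hAM : (∑' n : ℤ, (2:ℝ) ^ n * aF k γ 0 A_M n) = M)
    :
    ∃ C₂ > (0:ℝ),
      (∀ y : ℤ → ℝ, MemY β y → ∀ A : ℝ, 0 < A → A_M / 2 ≤ A →
        Ynorm (β - 1) (hF k γ A_M y A) ≤
          ENNReal.ofReal C₂ * (Ynorm β y) ^ 2 +
            ENNReal.ofReal C₂ * ENNReal.ofReal |A_M - A| * Ynorm β y) ∧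
      ∀ y₁ y₂ : ℤ → ℝ, MemY β y₁ → MemY β y₂ → ∀ A₁ A₂ : ℝ,
        A_M / 2 < A₁ → A_M / 2 < A₂ →
        Ynorm (β - 1) (fun n => hF k γ A_M y₁ A₁ n - hF k γ A_M y₂ A₂ n) ≤
          ENNReal.ofReal C₂ * Ynorm β (fun n => y₁ n - y₂ n) *
              (max (Ynorm β y₁) (Ynorm β y₂) + ENNReal.ofReal |A_M - A₁|) +
            ENNReal.ofReal C₂ * ENNReal.ofReal |A₁ - A₂| *
              ((Ynorm β y₂) ^ 2 + Ynorm β y₂) := by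
  have hβ0 : 0 < β := by linarith [hβ.1]
  have hk_pos' : ∀ x : ℝ, 0 < x → 0 < k x := fun x hx => hk_pos x hx.le
  have hγ_lim := tendsto_of_sub_isBigO_rpow (by linarith) hγ_0
  have hk_lim := tendsto_of_sub_isBigO_rpow (by linarith) hk_0
  obtain ⟨K, hK, hγK⟩ := exists_le_mul_max_one_rpow hβ0 hγ₀ hγ_cont hγ_pos hγ_lim hγ_inf
  obtain ⟨L₁, -, hL₁⟩ := exists_abs_log_two_mul_sub_le hβ0 hγ₀ hγ_cont hγ_pos hγ_lim hγ_inf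
  obtain ⟨L₂, -, hL₂⟩ := exists_abs_log_two_mul_sub_le (by linarith [hα.1]) hk₀
    (hk_cont.mono Set.Ioi_subset_Ici_self) hk_pos' hk_lim hk_inf
  have hB : ∀ n, alphaFactor k γ n ≤ Real.exp (L₂ + L₁) := alphaFactor_le fun n => by
    rw [log_thetaF_zero hk_pos' hγ_pos]
    exact (abs_sub _ _).trans
      (add_le_add (hL₂ _ (by positivity)) (hL₁ _ (by positivity)))
  obtain ⟨C, hC, h⟩ := exists_Ynorm_hF_sub_le (A_M := A_M) hβ (half_pos hAM_pos)
    (half_le_self hAM_pos.le) hγ_pos hK hγK hB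
  refine ⟨C, hC, fun y hy A _ hA => ?_, fun y₁ y₂ hy₁ hy₂ A₁ A₂ hA₁ hA₂ =>
    h y₁ y₂ hy₁ hy₂ A₁ A₂ hA₁.le hA₂.le⟩
  have h0 : Ynorm β (fun _ => 0) = 0 := by simp [Ynorm]
  have hy0 : MemY β (fun _ => 0) := by simp [MemY, h0]
  have hh := h y _ hy hy0 A A hA hA
  have hF0 : ∀ n, hF k γ A_M (fun _ => 0) A n = 0 := fun n => by simp [hF]
  simp only [hF0, sub_zero, h0, sub_self, abs_zero, ENNReal.ofReal_zero, mul_zero, zero_mul,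
    add_zero, max_eq_left (zero_le (a := Ynorm β y))] at hh
  refine hh.trans (le_of_eq ?_)
  ring
end
end
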